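/- arXiv:1609.08481 — 2 statements merged into one kernel-verified Lean document; each statement's English description precedes it below -/
import Mathlib

section
/- Let x ∈ ℒ_n have an orbit A·x with compact closure and let ε ∈ (0,1). Then there exists R > 0 such that for each 1 ≤ k ≤ n, every connected component of U_k^{x,ε} is (R, k−1)-almost affine, i.e. contained (in the logarithmic coordinates on A) in the R-neighborhood of some affine subspace of dimension k−1 that is a translate of a linear subspace of the trace-zero hyperplane. -/
open scoped BigOperators
open Matrix Topology Filter

noncomputable section

namespace SW

/-! ### Euclidean structure on `Fin n → ℝ` -/

/-- The standard Euclidean inner product on `Fin n → ℝ`. -/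
def einner {n : ℕ} (v w : Fin n → ℝ) : ℝ := ∑ i, v i * w i

/-- The Euclidean norm on `Fin n → ℝ`. -/
def enorm {n : ℕ} (v : Fin n → ℝ) : ℝ := Real.sqrt (∑ i, v i ^ 2)

lemma einner_add_left {n : ℕ} (u v w : Fin n → ℝ) :
    einner (u + v) w = einner u w + einner v w := by
  simp [einner, add_mul, Finset.sum_add_distrib]

lemma einner_neg_left {n : ℕ} (u w : Fin n → ℝ) : einner (-u) w = -einner u w := by
  simp [einner]

lemma einner_smul_left {n : ℕ} (c : ℝ) (u w : Fin n → ℝ) :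
    einner (c • u) w = c * einner u w := by
  simp [einner, Finset.mul_sum, mul_assoc]

/-! ### Covolume, rank, lattices, stability -/

/-- `√(det Gram)` of a finite family of vectors: the covolume of the ℤ-span of the family
(in the span of the family) when the family is linearly independent. -/
def gvol {n r : ℕ} (v : Fin r → (Fin n → ℝ)) : ℝ :=
  Real.sqrt (Matrix.det (Matrix.of fun i j => einner (v i) (v j)))

/-- `c` is the covolume of `Λ` in its real span, as computed from some ℤ-basis of `Λ` which is
linearly independent over `ℝ`. -/
def covolSpec {n : ℕ} (Λ : AddSubgroup (Fin n → ℝ)) (c : ℝ) : Prop :=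
  ∃ (r : ℕ) (v : Fin r → (Fin n → ℝ)), LinearIndependent ℝ v ∧
    Λ = AddSubgroup.closure (Set.range v) ∧ c = gvol v

/-- The covolume of a discrete subgroup `Λ ⊆ ℝⁿ` inside its real span (with `covol ⊥ = 1`). -/
def covol {n : ℕ} (Λ : AddSubgroup (Fin n → ℝ)) : ℝ := sInf {c | covolSpec Λ c}

/-- The rank of a discrete subgroup of `ℝⁿ`: the dimension of its real span. -/
def rk {n : ℕ} (Λ : AddSubgroup (Fin n → ℝ)) : ℕ :=
  Module.finrank ℝ (Submodule.span ℝ (Λ : Set (Fin n → ℝ)))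

/-- A lattice in `ℝⁿ`: a discrete subgroup spanning `ℝⁿ` (equivalently, cocompact). -/
def IsLattice {n : ℕ} (L : AddSubgroup (Fin n → ℝ)) : Prop :=
  DiscreteTopology ↥L ∧ Submodule.span ℝ (L : Set (Fin n → ℝ)) = ⊤

/-- A unimodular lattice: a lattice of covolume one. -/
def IsUnimodularLattice {n : ℕ} (L : AddSubgroup (Fin n → ℝ)) : Prop :=
  IsLattice L ∧ covol L = 1

/-- A stable lattice: a unimodular lattice all of whose subgroups have covolume at least one. -/
def IsStable {n : ℕ} (L : AddSubgroup (Fin n → ℝ)) : Prop :=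
  IsUnimodularLattice L ∧ ∀ Λ : AddSubgroup (Fin n → ℝ), Λ ≤ L → 1 ≤ covol Λ

/-! ### Matrices: the diagonal group `A`, `SL_n(ℤ)`, lattices from matrices -/

/-- The group `A` of positive diagonal matrices of determinant one (as a set of matrices). -/
def Apos (n : ℕ) : Set (Matrix (Fin n) (Fin n) ℝ) :=
  {a | ∃ d : Fin n → ℝ, (∀ i, 0 < d i) ∧ (∏ i, d i) = 1 ∧ a = Matrix.diagonal d}

/-- `SL_n(ℤ)` viewed as a set of real matrices. -/
def Gam (n : ℕ) : Set (Matrix (Fin n) (Fin n) ℝ) :=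
  {γ | γ.det = 1 ∧ ∀ i j, ∃ m : ℤ, γ i j = (m : ℝ)}

/-- The lattice `g·ℤⁿ` associated to a matrix `g`. -/
def latticeOf {n : ℕ} (g : Matrix (Fin n) (Fin n) ℝ) : AddSubgroup (Fin n → ℝ) :=
  AddSubgroup.closure (Set.range fun m : Fin n → ℤ => g.mulVec fun i => (m i : ℝ))

/-- The image `g·L` of a lattice under a matrix. -/
def mapLat {n : ℕ} (g : Matrix (Fin n) (Fin n) ℝ) (L : AddSubgroup (Fin n → ℝ)) :
    AddSubgroup (Fin n → ℝ) :=
  AddSubgroup.map (Matrix.mulVecLin g).toAddMonoidHom L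

/-- The full preimage `A·g·Γ` in `SL_n(ℝ)` of the orbit `A·[g] ⊆ ℒ_n`; a point `[h] ∈ ℒ_n`
lies in the closure of `A·[g]` iff `h ∈ closure (AOrbit g)`. -/
def AOrbit {n : ℕ} (g : Matrix (Fin n) (Fin n) ℝ) : Set (Matrix (Fin n) (Fin n) ℝ) :=
  {p | ∃ a ∈ Apos n, ∃ γ ∈ Gam n, p = a * g * γ}

/-- The orbit `A·[g] ⊆ ℒ_n` is bounded (has compact closure). -/
def HasBoundedAOrbit {n : ℕ} (g : Matrix (Fin n) (Fin n) ℝ) : Prop :=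
  ∃ K : Set (Matrix (Fin n) (Fin n) ℝ), IsCompact K ∧
    ∀ a ∈ Apos n, ∃ γ ∈ Gam n, a * g * γ ∈ K

/-! ### `α`, `Min_δ`, `V_δ`, `dim_δ` -/

/-- `α(x) = min { |Λ|^{1/r(Λ)} : Λ a nonzero subgroup of x }`. -/
def alpha {n : ℕ} (x : AddSubgroup (Fin n → ℝ)) : ℝ :=
  sInf {c | ∃ Λ : AddSubgroup (Fin n → ℝ), Λ ≤ x ∧ Λ ≠ ⊥ ∧ c = covol Λ ^ ((rk Λ : ℝ)⁻¹)}

/-- `α_k(x) = min { |Λ|^{1/k} : Λ a rank-`k` subgroup of x }`. -/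
def alphak {n : ℕ} (k : ℕ) (x : AddSubgroup (Fin n → ℝ)) : ℝ :=
  sInf {c | ∃ Λ : AddSubgroup (Fin n → ℝ), Λ ≤ x ∧ rk Λ = k ∧ c = covol Λ ^ ((k : ℝ)⁻¹)}

/-- `Min_δ(x)`: nonzero subgroups nearly attaining `α(x)`. -/
def MinSet {n : ℕ} (δ : ℝ) (x : AddSubgroup (Fin n → ℝ)) : Set (AddSubgroup (Fin n → ℝ)) :=
  {Λ | Λ ≤ x ∧ Λ ≠ ⊥ ∧ covol Λ ^ ((rk Λ : ℝ)⁻¹) < (1 + δ) * alpha x}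

/-- `V_δ(x)`: the span of the subgroups in `Min_δ(x)`. -/
def Vdelta {n : ℕ} (δ : ℝ) (x : AddSubgroup (Fin n → ℝ)) : Submodule ℝ (Fin n → ℝ) :=
  Submodule.span ℝ (⋃ Λ ∈ MinSet δ x, (Λ : Set (Fin n → ℝ)))

/-- `dim_δ(x) = dim V_δ(x)`. -/
def dimdelta {n : ℕ} (δ : ℝ) (x : AddSubgroup (Fin n → ℝ)) : ℕ :=
  Module.finrank ℝ (Vdelta δ x)

/-- `U_k^{x,ε} ⊆ A`: those `a` for which `δ ↦ dim_δ(ax)` equals `k` near `kε`. -/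
def Uset {n : ℕ} (x : AddSubgroup (Fin n → ℝ)) (ε : ℝ) (k : ℕ) :
    Set (Matrix (Fin n) (Fin n) ℝ) :=
  {a | a ∈ Apos n ∧ ∃ s ∈ 𝓝 ((k : ℝ) * ε), ∀ δ ∈ s, dimdelta δ (mapLat a x) = k}

/-- Logarithmic coordinates on the diagonal group. -/
def logCoord {n : ℕ} (a : Matrix (Fin n) (Fin n) ℝ) : Fin n → ℝ := fun i => Real.log (a i i)

/-! ### Covering radius -/

/-- The covering radius `covrad(L) = sup_u inf_{v ∈ L} ‖u - v‖`. -/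
def covrad {n : ℕ} (L : AddSubgroup (Fin n → ℝ)) : ℝ :=
  ⨆ u : Fin n → ℝ, ⨅ v : L, enorm (u - (v : Fin n → ℝ))

/-- `[g]` is a local maximum of `covrad : ℒ_d → ℝ` (phrased via the open quotient
`SL_d(ℝ) → ℒ_d`). -/
def IsLocalMaxCovrad {d : ℕ} (g : Matrix (Fin d) (Fin d) ℝ) : Prop :=
  ∃ W ∈ 𝓝 g, ∀ g' ∈ W, Matrix.det g' = 1 → covrad (latticeOf g') ≤ covrad (latticeOf g)

/-! ### Block upper triangular form -/

/-- Offset of the `i`-th diagonal block. -/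
def off {k : ℕ} (ns : Fin k → ℕ) (i : Fin k) : ℕ :=
  ∑ j ∈ Finset.univ.filter (fun j => j < i), ns j

lemma off_add_lt {k : ℕ} (ns : Fin k → ℕ) (i : Fin k) (a : Fin (ns i)) :
    off ns i + (a : ℕ) < ∑ j, ns j := by
  unfold off
  have hins : i ∉ Finset.univ.filter (fun j => j < i) := by simp
  have h2 : ∑ j ∈ insert i (Finset.univ.filter (fun j => j < i)), ns j ≤ ∑ j, ns j :=
    Finset.sum_le_sum_of_subset (Finset.subset_univ _)
  rw [Finset.sum_insert hins] at h2
  have := a.isLt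
  omega

/-- The position, in `Fin n`, of the `a`-th coordinate of the `i`-th block. -/
def blockEmb {n k : ℕ} (ns : Fin k → ℕ) (hsum : (∑ j, ns j) = n) (i : Fin k)
    (a : Fin (ns i)) : Fin n :=
  ⟨off ns i + (a : ℕ), hsum ▸ off_add_lt ns i a⟩

/-- `g` is block upper triangular with diagonal blocks `G i` (block sizes `ns`). -/
def IsBlockUT {n k : ℕ} (ns : Fin k → ℕ) (hsum : (∑ j, ns j) = n)
    (g : Matrix (Fin n) (Fin n) ℝ) (G : ∀ i, Matrix (Fin (ns i)) (Fin (ns i)) ℝ) : Prop :=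
  (∀ (i : Fin k) (a b : Fin (ns i)),
      g (blockEmb ns hsum i a) (blockEmb ns hsum i b) = G i a b) ∧
  (∀ (i j : Fin k) (a : Fin (ns i)) (b : Fin (ns j)), j < i →
      g (blockEmb ns hsum i a) (blockEmb ns hsum j b) = 0)

/-! ### Mordell constant -/

/-- The symmetric box `[-a₁,a₁] × ⋯ × [-aₙ,aₙ]` is admissible for `L`: its interior contains
no nonzero point of `L`. -/
def IsAdmissibleBox {n : ℕ} (L : AddSubgroup (Fin n → ℝ)) (a : Fin n → ℝ) : Prop :=
  (∀ i, 0 < a i) ∧ ∀ v ∈ L, v ≠ 0 → ∃ i, a i ≤ |v i|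

/-- The Mordell constant `κ(L) = 2⁻ⁿ sup { Vol(B) : B admissible symmetric box for L }`. -/
def mordellConst {n : ℕ} (L : AddSubgroup (Fin n → ℝ)) : ℝ :=
  (1 / 2 ^ n) * sSup {V | ∃ a : Fin n → ℝ, IsAdmissibleBox L a ∧ V = ∏ i, 2 * a i}

/-! ### Hermite constant -/

/-- Length of a shortest nonzero vector of `L`. -/
def shortest {m : ℕ} (L : AddSubgroup (Fin m → ℝ)) : ℝ :=
  sInf {t | ∃ w ∈ L, w ≠ 0 ∧ t = enorm w}

/-- The Hermite constant `γ_m`. -/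
def hermiteConst (m : ℕ) : ℝ :=
  sSup {c | ∃ L : AddSubgroup (Fin m → ℝ), IsUnimodularLattice L ∧ c = shortest L ^ 2}

/-! ### Korkine–Zolotarev reduction -/

/-- `v 0, …, v (n-1)` is a Korkine–Zolotarev reduced basis of `x`: it is a ℤ-basis, and for
each `i` the orthogonal projection of `v i` onto `span(v 0, …, v (i-1))^⊥` is shortest among the
nonzero such projections of vectors of `x` (projection lengths are expressed through Gram
determinants: the projection of `w` has length `gvol (v 0, …, v (i-1), w) / gvol (v 0, …, v (i-1))`). -/
def IsKZBasis {n : ℕ} (x : AddSubgroup (Fin n → ℝ)) (v : ℕ → (Fin n → ℝ)) : Prop :=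
  LinearIndependent ℝ (fun j : Fin n => v (j : ℕ)) ∧
  x = AddSubgroup.closure (v '' Set.Iio n) ∧
  ∀ i < n, ∀ w ∈ x, w ∉ Submodule.span ℝ (v '' Set.Iio i) →
    gvol (Fin.snoc (fun j : Fin i => v (j : ℕ)) (v i)) ≤
      gvol (Fin.snoc (fun j : Fin i => v (j : ℕ)) w)

/-- `A 0, …, A (n-1)` are the diagonal Korkine–Zolotarev coefficients of `x`: the lengths of
the successive orthogonal projections in a KZ reduced basis, i.e.
`A i = gvol (v 0, …, v i) / gvol (v 0, …, v (i-1))`. -/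
def HasKZCoeffs {n : ℕ} (x : AddSubgroup (Fin n → ℝ)) (A : ℕ → ℝ) : Prop :=
  ∃ v : ℕ → (Fin n → ℝ), IsKZBasis x v ∧
    ∀ i < n, A i * gvol (fun j : Fin i => v (j : ℕ)) = gvol (fun j : Fin (i + 1) => v (j : ℕ))

/-! ### Orthogonal complements and projections of lattices -/

/-- The orthogonal complement of a subspace `V ⊆ ℝⁿ`. -/
def orthoC {n : ℕ} (V : Submodule ℝ (Fin n → ℝ)) : Submodule ℝ (Fin n → ℝ) where
  carrier := {w | ∀ v ∈ V, einner w v = 0}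
  zero_mem' := by intro v hv; simp [einner]
  add_mem' := by intro a b ha hb v hv; rw [einner_add_left, ha v hv, hb v hv, add_zero]
  smul_mem' := by intro c w hw v hv; rw [einner_smul_left, hw v hv, mul_zero]

/-- The image `π(x)` of `x` under the orthogonal projection `π : ℝⁿ → V^⊥`:
`p = π(u)` iff `p ⊥ V` and `u - p ∈ V`. -/
def projLat {n : ℕ} (V : Submodule ℝ (Fin n → ℝ)) (x : AddSubgroup (Fin n → ℝ)) :
    AddSubgroup (Fin n → ℝ) where
  carrier := {p | (∀ v ∈ V, einner p v = 0) ∧ ∃ u ∈ x, u - p ∈ V}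
  zero_mem' := ⟨by intro v hv; simp [einner], 0, x.zero_mem, by rw [sub_zero]; exact V.zero_mem⟩
  add_mem' := by
    rintro p q ⟨hp1, u1, hu1, hp2⟩ ⟨hq1, u2, hu2, hq2⟩
    refine ⟨fun v hv => by rw [einner_add_left, hp1 v hv, hq1 v hv, add_zero],
      u1 + u2, x.add_mem hu1 hu2, ?_⟩
    have h : u1 + u2 - (p + q) = u1 - p + (u2 - q) := by abel
    rw [h]; exact V.add_mem hp2 hq2
  neg_mem' := by
    rintro p ⟨hp1, u, hu, hp2⟩
    refine ⟨fun v hv => by rw [einner_neg_left, hp1 v hv, neg_zero],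
      -u, x.neg_mem hu, ?_⟩
    have h : -u - -p = -(u - p) := by abel
    rw [h]; exact V.neg_mem hp2

end SW

namespace SW

/-- Cauchy–Binet, indexed by all functions rather than by subsets. -/
lemma det_mul_eq_sum {R : Type*} [CommRing R] {n k : ℕ} (P : Matrix (Fin k) (Fin n) R)
    (Q : Matrix (Fin n) (Fin k) R) :
    (P * Q).det = ∑ σ : Fin k → Fin n, (∏ i, P i (σ i)) * (Q.submatrix σ id).det := by
  have h : P * Q = fun i => ∑ j, P i j • Q j := by
    ext i l
    simp [Matrix.mul_apply, Finset.sum_apply]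
  have := (Matrix.detRowAlternating (R := R) (n := Fin k)).toMultilinearMap.map_sum
    (fun i (j : Fin n) => P i j • Q j)
  rw [h]
  refine this.trans (Finset.sum_congr rfl fun σ _ => ?_)
  exact (Matrix.detRowAlternating (R := R) (n := Fin k)).toMultilinearMap.map_smul_univ
    (fun i => P i (σ i)) (fun i => Q (σ i))

/-- The maximal minors of a product `h * B`. -/
lemma det_submatrix_mul_eq_sum {R : Type*} [CommRing R] {n k : ℕ}
    (h : Matrix (Fin n) (Fin n) R) (B : Matrix (Fin n) (Fin k) R) (σ : Fin k → Fin n) :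
    ((h * B).submatrix σ id).det
      = ∑ τ : Fin k → Fin n, (∏ i, h (σ i) (τ i)) * (B.submatrix τ id).det := by
  have : (h * B).submatrix σ id = h.submatrix σ id * B := by
    ext i j
    simp [Matrix.mul_apply]
  rw [this, det_mul_eq_sum]
  rfl

lemma det_submatrix_mul_right {R : Type*} [CommRing R] {n k : ℕ}
    (B : Matrix (Fin n) (Fin k) R) (P : Matrix (Fin k) (Fin k) R) (σ : Fin k → Fin n) :
    ((B * P).submatrix σ id).det = (B.submatrix σ id).det * P.det := by
  have : (B * P).submatrix σ id = B.submatrix σ id * P := by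
    ext i j
    simp [Matrix.mul_apply]
  rw [this, Matrix.det_mul]

/-- Symmetrised Cauchy–Binet formula for a Gram determinant. -/
lemma factorial_mul_det_transpose_mul {R : Type*} [CommRing R] {n k : ℕ}
    (B : Matrix (Fin n) (Fin k) R) :
    (k.factorial : R) * (Bᵀ * B).det = ∑ σ : Fin k → Fin n, (B.submatrix σ id).det ^ 2 := by
  have h1 : ∀ π : Equiv.Perm (Fin k), (Bᵀ * B).det
      = ∑ σ : Fin k → Fin n, (Equiv.Perm.sign π : R) *
          (∏ i, B (σ (π i)) i) * (B.submatrix σ id).det := by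
    intro π
    rw [det_mul_eq_sum, ← (Equiv.arrowCongr π.symm (Equiv.refl (Fin n))).sum_comp]
    refine Finset.sum_congr rfl fun σ _ => ?_
    have h2 : (B.submatrix (Equiv.arrowCongr π.symm (Equiv.refl (Fin n)) σ) id)
        = (B.submatrix σ id).submatrix π id := by
      ext i j
      simp [Equiv.arrowCongr]
    rw [h2, Matrix.det_permute]
    simp [Equiv.arrowCongr]
    ring
  have h3 : ∑ _π : Equiv.Perm (Fin k), (Bᵀ * B).det = (k.factorial : R) * (Bᵀ * B).det := by
    simp [Fintype.card_perm]
  rw [← h3, Finset.sum_congr rfl fun π _ => h1 π, Finset.sum_comm]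
  refine Finset.sum_congr rfl fun σ _ => ?_
  rw [← Finset.sum_mul, sq, Matrix.det_apply (B.submatrix σ id)]
  congr 1
  refine Finset.sum_congr rfl fun π _ => ?_
  simp [Units.smul_def]

/-- Cramer's rule: the entries of `B * adj (B_σ)` are maximal minors of `B`. -/
lemma mul_adjugate_submatrix_apply {R : Type*} [CommRing R] {n k : ℕ}
    (B : Matrix (Fin n) (Fin k) R) (σ : Fin k → Fin n) (j : Fin n) (i : Fin k) :
    (B * (B.submatrix σ id).adjugate) j i
      = (B.submatrix (Function.update σ i j) id).det := by
  have h1 : B.submatrix (Function.update σ i j) id = (B.submatrix σ id).updateRow i (B j) := by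
    ext a b
    by_cases hab : a = i
    · subst hab; simp
    · simp [hab, Function.update_of_ne, Matrix.updateRow_ne]
  rw [h1, ← Matrix.cramer_transpose_apply, Matrix.cramer_eq_adjugate_mulVec,
    ← Matrix.adjugate_transpose]
  simp [Matrix.mul_apply, Matrix.mulVec, dotProduct, mul_comm]

/-- A real matrix with linearly independent columns has a nonzero maximal minor. -/
lemma exists_det_submatrix_ne_zero {n k : ℕ} (B : Matrix (Fin n) (Fin k) ℝ)
    (hB : LinearIndependent ℝ Bᵀ) : ∃ σ : Fin k → Fin n, (B.submatrix σ id).det ≠ 0 := by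
  by_contra! h
  have h0 : (Bᵀ * B).det = 0 := by
    have := factorial_mul_det_transpose_mul B
    simp only [h] at this
    have hk : (k.factorial : ℝ) ≠ 0 := by positivity
    simpa [hk] using this
  obtain ⟨v, hv, hv0⟩ := Matrix.exists_mulVec_eq_zero_iff.mpr h0
  have h1 : B *ᵥ v = 0 := by
    have : (B *ᵥ v) ⬝ᵥ (B *ᵥ v) = 0 := by
      rw [Matrix.dotProduct_mulVec, ← Matrix.mulVec_transpose, Matrix.mulVec_mulVec, hv0,
        zero_dotProduct]
    exact dotProduct_self_eq_zero.mp this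
  apply hv
  have h2 := (Fintype.linearIndependent_iff.mp hB) v
  ext i
  refine h2 ?_ i
  ext j
  have := congrFun h1 j
  simpa [Matrix.mulVec, dotProduct, mul_comm] using this

/-- The `ℓ¹`-norm of the vector of maximal minors of `diag(exp t) * B`. -/
def minorNorm {n k : ℕ} (B : Matrix (Fin n) (Fin k) ℝ) (t : Fin n → ℝ) : ℝ :=
  ∑ σ : Fin k → Fin n, Real.exp (∑ i, t (σ i)) * |(B.submatrix σ id).det|

lemma exp_mul_minor_le_minorNorm {n k : ℕ} (B : Matrix (Fin n) (Fin k) ℝ) (t : Fin n → ℝ)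
    (σ : Fin k → Fin n) :
    Real.exp (∑ i, t (σ i)) * |(B.submatrix σ id).det| ≤ minorNorm B t :=
  Finset.single_le_sum
    (f := fun σ : Fin k → Fin n => Real.exp (∑ i, t (σ i)) * |(B.submatrix σ id).det|)
    (fun τ _ => by positivity) (Finset.mem_univ σ)

lemma minorNorm_nonneg {n k : ℕ} (B : Matrix (Fin n) (Fin k) ℝ) (t : Fin n → ℝ) :
    0 ≤ minorNorm B t := Finset.sum_nonneg fun σ _ => by positivity

lemma minorNorm_diagonal_mul {n k : ℕ} (B : Matrix (Fin n) (Fin k) ℝ) (s t : Fin n → ℝ) :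
    minorNorm (Matrix.diagonal (fun i => Real.exp (s i)) * B) t = minorNorm B (s + t) := by
  unfold minorNorm
  refine Finset.sum_congr rfl fun σ _ => ?_
  have h : (Matrix.diagonal (fun i => Real.exp (s i)) * B).submatrix σ id
      = Matrix.of fun i j => Real.exp (s (σ i)) * B.submatrix σ id i j := by
    ext i j
    simp [Matrix.diagonal_mul]
  rw [h, Matrix.det_mul_column, abs_mul, ← Real.exp_sum, Real.abs_exp]
  simp only [Pi.add_apply, Finset.sum_add_distrib, Real.exp_add]
  ring

lemma minorNorm_mul_right {n k : ℕ} (B : Matrix (Fin n) (Fin k) ℝ) (P : Matrix (Fin k) (Fin k) ℝ)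
    (t : Fin n → ℝ) : minorNorm (B * P) t = minorNorm B t * |P.det| := by
  unfold minorNorm
  rw [Finset.sum_mul]
  refine Finset.sum_congr rfl fun σ _ => ?_
  rw [det_submatrix_mul_right, abs_mul, mul_assoc]

lemma continuous_minorNorm {n k : ℕ} :
    Continuous fun p : Matrix (Fin n) (Fin k) ℝ × (Fin n → ℝ) => minorNorm p.1 p.2 := by
  unfold minorNorm
  refine continuous_finsetSum _ fun σ _ => ?_
  refine Continuous.mul (by fun_prop) ?_
  exact ((Continuous.matrix_submatrix continuous_fst σ id).matrix_det).abs

/-- `minorNorm B` is a convex function: it is a positive combination of exponentials of linear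
forms. -/
lemma convexOn_minorNorm {n k : ℕ} (B : Matrix (Fin n) (Fin k) ℝ) :
    ConvexOn ℝ Set.univ (minorNorm B) := by
  refine ⟨convex_univ, fun s _ t _ a b ha hb hab => ?_⟩
  simp only [minorNorm, smul_eq_mul, Finset.mul_sum, ← Finset.sum_add_distrib]
  refine Finset.sum_le_sum fun σ _ => ?_
  have h := convexOn_exp.2 (Set.mem_univ (∑ i, s (σ i))) (Set.mem_univ (∑ i, t (σ i))) ha hb hab
  have h2 : ∑ i, (a • s + b • t) (σ i) = a • (∑ i, s (σ i)) + b • (∑ i, t (σ i)) := by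
    simp [Finset.sum_add_distrib, Finset.mul_sum]
  rw [h2]
  calc _ ≤ (a • Real.exp (∑ i, s (σ i)) + b • Real.exp (∑ i, t (σ i)))
        * |(B.submatrix σ id).det| := by gcongr
    _ = _ := by simp only [smul_eq_mul]; ring

/-- If every trace-zero diagonal flow keeps the minors of `B` bounded below, they cannot stay
bounded on a `k`-dimensional space of trace-zero directions. -/
lemma false_of_minorNorm_bounded_on_flat {n k : ℕ} (hk : 0 < k) (B : Matrix (Fin n) (Fin k) ℝ)
    {c C : ℝ} (hc : 0 < c) (hlow : ∀ t : Fin n → ℝ, ∑ i, t i = 0 → c ≤ minorNorm B t)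
    (e : Fin k → Fin n → ℝ) (he : LinearIndependent ℝ e)
    (hup : ∀ y : Fin k → ℝ, minorNorm B (∑ i, y i • e i) ≤ C) : False := by
  have hN0 : 0 < minorNorm B 0 := hc.trans_le (hlow 0 (by simp))
  obtain ⟨σ, hσ⟩ : ∃ σ : Fin k → Fin n, (B.submatrix σ id).det ≠ 0 := by
    by_contra! h
    simp [minorNorm, h] at hN0
  -- weights occurring in `B` vanish on the flat
  have hw : ∀ (y : Fin k → ℝ) (τ : Fin k → Fin n), (B.submatrix τ id).det ≠ 0 →
      ∑ i, (∑ l, y l • e l) (τ i) = 0 := by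
    intro y τ hτ
    by_contra hne
    set w := ∑ i, (∑ l, y l • e l) (τ i) with hwdef
    set d := |(B.submatrix τ id).det| with hd
    have hdpos : 0 < d := abs_pos.mpr hτ
    have key : ∀ s : ℝ, Real.exp (s * w) * d ≤ C := by
      intro s
      refine le_trans (le_of_eq ?_) ((exp_mul_minor_le_minorNorm B _ τ).trans (hup (s • y)))
      rw [hwdef, Finset.mul_sum]
      simp [Finset.sum_apply, Finset.mul_sum, mul_assoc, hd]
    have h1 := key (C / d / w)
    rw [div_mul_cancel₀ _ hne] at h1
    have h2 := Real.add_one_le_exp (C / d)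
    have h3 : (C / d + 1) * d ≤ C := (mul_le_mul_of_nonneg_right h2 hdpos.le).trans h1
    rw [add_mul, div_mul_cancel₀ _ hdpos.ne'] at h3
    linarith
  -- a nonzero vector of the flat vanishing on the rows `σ`
  obtain ⟨y, hy0, hy⟩ : ∃ y : Fin k → ℝ, y ≠ 0 ∧ ∀ i, (∑ l, y l • e l) (σ i) = 0 := by
    let f : (Fin k → ℝ) →ₗ[ℝ] (Fin k → ℝ) :=
      LinearMap.funLeft ℝ ℝ σ ∘ₗ Fintype.linearCombination ℝ e
    have hf : ∀ y i, f y i = (∑ l, y l • e l) (σ i) := fun y i => by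
      simp [f, LinearMap.funLeft_apply, Fintype.linearCombination_apply]
    have hns : ¬ Function.Surjective f := by
      intro hs
      obtain ⟨y, hy⟩ := hs (fun _ => 1)
      have h1 := hw y σ hσ
      simp only [← hf, hy] at h1
      simp at h1
      omega
    have hni : ¬ Function.Injective f := fun h => hns (LinearMap.injective_iff_surjective.mp h)
    rw [← LinearMap.ker_eq_bot, Submodule.eq_bot_iff] at hni
    push Not at hni
    obtain ⟨y, hy, hy0⟩ := hni
    exact ⟨y, hy0, fun i => by rw [← hf, LinearMap.mem_ker.mp hy]; rfl⟩
  set t := ∑ l, y l • e l with ht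
  have ht0 : t ≠ 0 := fun h => hy0 (funext fun i => Fintype.linearIndependent_iff.mp he y h i)
  have hrow : ∀ j, t j ≠ 0 → ∀ l, B j l = 0 := by
    intro j hj
    have h1 : ∀ i, (B.submatrix (Function.update σ i j) id).det = 0 := by
      intro i
      by_contra hne
      have h2 := hw y _ hne
      rw [← ht, Finset.sum_eq_single i] at h2
      · simp at h2; exact hj h2
      · intro a _ ha
        rw [Function.update_of_ne ha]
        exact hy a
      · simp
    have h2 : (B * (B.submatrix σ id).adjugate) * (B.submatrix σ id)
        = (B.submatrix σ id).det • B := by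
      rw [Matrix.mul_assoc, Matrix.adjugate_mul]; simp
    intro l
    have h3 := congrFun (congrFun h2 j) l
    rw [Matrix.mul_apply] at h3
    simp only [mul_adjugate_submatrix_apply, h1, zero_mul, Finset.sum_const_zero,
      Matrix.smul_apply, smul_eq_mul] at h3
    exact (mul_eq_zero.mp h3.symm).resolve_left hσ
  -- contract the coordinates where `t` vanishes
  obtain ⟨j₀, hj₀⟩ : ∃ j, t j ≠ 0 := Function.ne_iff.mp ht0
  set Z := Finset.univ.filter fun j => t j = 0 with hZ
  set Y := Finset.univ.filter fun j => ¬ t j = 0 with hY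
  have hYpos : (0 : ℝ) < Y.card := by
    have : 0 < Y.card := Finset.card_pos.mpr ⟨j₀, by simp [hY, hj₀]⟩
    exact_mod_cast this
  let s : ℝ → Fin n → ℝ := fun T j => if t j = 0 then -T else T * Z.card / Y.card
  have hs0 : ∀ T, ∑ j, s T j = 0 := by
    intro T
    simp only [s, Finset.sum_ite, Finset.sum_const, nsmul_eq_mul, ← hZ, ← hY]
    field_simp
    ring
  have hle : ∀ T, minorNorm B (s T) = Real.exp (-T * k) * minorNorm B 0 := by
    intro T
    unfold minorNorm
    rw [Finset.mul_sum]
    refine Finset.sum_congr rfl fun τ _ => ?_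
    by_cases hτ : (B.submatrix τ id).det = 0
    · simp [hτ]
    · have h1 : ∀ i, t (τ i) = 0 := by
        intro i
        by_contra hne
        exact hτ (Matrix.det_eq_zero_of_row_eq_zero i fun l => hrow _ hne l)
      have h2 : ∑ i, s T (τ i) = -T * k := by simp [s, h1, mul_comm]
      rw [h2]; simp
  have h1 := hlow _ (hs0 (minorNorm B 0 / c))
  rw [hle] at h1
  have h4 : (1 : ℝ) ≤ k := by exact_mod_cast hk
  set N := minorNorm B 0
  have hNc : 0 < N / c := div_pos hN0 hc
  have h5 : Real.exp (-(N / c) * k) ≤ Real.exp (-(N / c)) := by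
    apply Real.exp_le_exp.mpr; nlinarith
  have h6 : c * Real.exp (N / c) ≤ N := by
    calc c * Real.exp (N / c) ≤ Real.exp (-(N / c)) * N * Real.exp (N / c) := by
          gcongr
          exact h1.trans (by gcongr)
      _ = N := by rw [Real.exp_neg]; field_simp
  have h7 := Real.add_one_le_exp (N / c)
  have h8 : c * (N / c + 1) ≤ N := (by gcongr : c * (N / c + 1) ≤ c * Real.exp (N / c)).trans h6
  rw [mul_add, mul_div_cancel₀ _ hc.ne'] at h8
  linarith

lemma exists_submodule_finrank_eq {E : Type*} [AddCommGroup E] [Module ℝ E] [FiniteDimensional ℝ E]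
    (S : Submodule ℝ E) (d : ℕ) (hS : Module.finrank ℝ S ≤ d) (hd : d ≤ Module.finrank ℝ E) :
    ∃ S' : Submodule ℝ E, S ≤ S' ∧ Module.finrank ℝ S' = d := by
  induction d, hS using Nat.le_induction with
  | base => exact ⟨S, le_rfl, rfl⟩
  | succ m hm ih =>
    obtain ⟨S', hSS', hS'⟩ := ih (by omega)
    obtain ⟨v, hv⟩ : ∃ v, v ∉ S' := by
      by_contra! h
      have : S' = ⊤ := (Submodule.eq_top_iff').mpr h
      rw [this, finrank_top] at hS'
      omega
    exact ⟨S' ⊔ Submodule.span ℝ {v}, hSS'.trans le_sup_left,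
      by rw [Submodule.finrank_sup_span_singleton hv, hS']⟩

section AlmostAffine

variable {E : Type*} [NormedAddCommGroup E] [InnerProductSpace ℝ E]

open scoped InnerProductSpace

/-- Greedy selection of farthest points: a finite subset of a convex set is either close to a
subspace of dimension less than `j`, or the convex set contains a large `j`-dimensional box. -/
lemma near_subspace_or_box_subset (Q : Set E) (hQ : Convex ℝ Q) (hQ0 : (0 : E) ∈ Q)
    (F : Finset E) (hF : F.Nonempty) (hFQ : (F : Set E) ⊆ Q) {R : ℝ} (hR : 0 < R) (j : ℕ) :
    (∃ S : Submodule ℝ E, FiniteDimensional ℝ S ∧ Module.finrank ℝ S < j ∧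
      ∀ p ∈ F, ∃ w ∈ S, ‖p - w‖ ≤ R) ∨
    ∃ (e : Fin j → E) (L b : Fin j → ℝ), Orthonormal ℝ e ∧ (∀ i, R < L i) ∧
      (∀ p ∈ F, ∀ i, abs ⟪e i, p⟫_ℝ ≤ L i) ∧ (∀ i, |b i| ≤ 1) ∧
      ∀ x : Fin j → ℝ, (∀ i, |x i - b i| ≤ (1 / 12) ^ j) → ∑ i, (x i * L i) • e i ∈ Q := by
  induction j with
  | zero =>
    refine Or.inr ⟨Fin.elim0, Fin.elim0, Fin.elim0, Orthonormal.of_isEmpty _, fun i => i.elim0,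
      fun _ _ i => i.elim0, fun i => i.elim0, fun x _ => by simpa using hQ0⟩
  | succ j ih =>
    rcases ih with ⟨S, hS, hSj, hSF⟩ | ⟨e, L, b, he, hL, hLF, hb, hbox⟩
    · exact Or.inl ⟨S, hS, by omega, hSF⟩
    obtain ⟨q, hqF, hq⟩ := F.exists_max_image (fun p => ‖p - ∑ i, ⟪e i, p⟫_ℝ • e i‖) hF
    set r := q - ∑ i, ⟪e i, q⟫_ℝ • e i with hr
    have hperp : ∀ (p : E) i, ⟪e i, p - ∑ l, ⟪e l, p⟫_ℝ • e l⟫_ℝ = 0 := by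
      intro p i
      rw [inner_sub_right, he.inner_right_fintype, sub_self]
    rcases le_or_gt ‖r‖ R with hrR | hrR
    · left
      refine ⟨Submodule.span ℝ (Set.range e),
        FiniteDimensional.span_of_finite ℝ (Set.finite_range e), ?_, fun p hp =>
        ⟨∑ i, ⟪e i, p⟫_ℝ • e i, ?_, (hq p hp).trans hrR⟩⟩
      · have := finrank_range_le_card (R := ℝ) e
        simp only [Set.finrank, Fintype.card_fin] at this
        omega
      · exact Submodule.sum_mem _ fun i _ => Submodule.smul_mem _ _ (Submodule.subset_span ⟨i, rfl⟩)
    · right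
      have hr0 : 0 < ‖r‖ := hR.trans hrR
      set u := ‖r‖⁻¹ • r with hu
      have hu1 : ‖u‖ = 1 := by
        rw [hu, norm_smul, norm_inv, norm_norm, inv_mul_cancel₀ hr0.ne']
      have hue : ∀ i, ⟪u, e i⟫_ℝ = 0 := by
        intro i
        rw [hu, real_inner_smul_left, real_inner_comm, hperp, mul_zero]
      have hqu : q = ∑ i, ⟪e i, q⟫_ℝ • e i + ‖r‖ • u := by
        rw [hu, smul_smul, mul_inv_cancel₀ hr0.ne', one_smul, hr]; abel
      set c : Fin j → ℝ := fun i => ⟪e i, q⟫_ℝ / L i with hc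
      have hLpos : ∀ i, 0 < L i := fun i => hR.trans (hL i)
      have hc1 : ∀ i, |c i| ≤ 1 := by
        intro i
        rw [hc]
        simp only
        rw [abs_div, abs_of_pos (hLpos i), div_le_one (hLpos i)]
        exact hLF q hqF i
      refine ⟨Matrix.vecCons u e, Matrix.vecCons ‖r‖ L,
        Matrix.vecCons (1 / 2) (fun i => (b i + c i) / 2), ?_, ?_, ?_, ?_, ?_⟩
      · exact orthonormal_vecCons_iff.mpr ⟨hu1, hue, he⟩
      · intro i
        refine Fin.cases ?_ (fun i => ?_) i
        · simpa using hrR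
        · simpa using hL i
      · intro p hp i
        refine Fin.cases ?_ (fun i => ?_) i
        · have h1 : ⟪u, p⟫_ℝ = ⟪u, p - ∑ i, ⟪e i, p⟫_ℝ • e i⟫_ℝ := by
            rw [inner_sub_right, inner_sum]
            simp [real_inner_smul_right, hue]
          simp only [Matrix.cons_val_zero]
          rw [h1]
          refine (abs_real_inner_le_norm _ _).trans ?_
          rw [hu1, one_mul]
          exact hq p hp
        · simpa using hLF p hp i
      · intro i
        refine Fin.cases ?_ (fun i => ?_) i
        · simp only [Matrix.cons_val_zero]; norm_num
        · simp only [Matrix.cons_val_succ]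
          have h1 := abs_le.mp (hb i)
          have h2 := abs_le.mp (hc1 i)
          exact abs_le.mpr ⟨by linarith [h1.1, h2.1], by linarith [h1.2, h2.2]⟩
      · intro x hx
        set η : ℝ := (1 / 12) ^ j with hη
        have hη0 : 0 < η := by positivity
        have hη1 : η ≤ 1 := pow_le_one₀ (by norm_num) (by norm_num)
        have hηs : (1 / 12 : ℝ) ^ (j + 1) = η / 12 := by rw [pow_succ, hη]; ring
        rw [hηs] at hx
        have hs := hx 0
        simp only [Matrix.cons_val_zero] at hs
        set s := x 0 with hsdef
        obtain ⟨hs1, hs2⟩ := abs_le.mp hs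
        have h1s : 1 / 4 ≤ 1 - s := by linarith
        have h1s' : 1 - s ≠ 0 := by linarith
        set x' : Fin j → ℝ := fun i => (x i.succ - s * c i) / (1 - s) with hx'
        have hx'b : ∀ i, |x' i - b i| ≤ η := by
          intro i
          have h3 := hx i.succ
          simp only [Matrix.cons_val_succ] at h3
          have h4 : x' i - b i = (x i.succ - s * c i - (1 - s) * b i) / (1 - s) := by
            rw [hx']; field_simp
          rw [h4, abs_div, abs_of_pos (by linarith : 0 < 1 - s), div_le_iff₀ (by linarith)]
          have h5 : x i.succ - s * c i - (1 - s) * b i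
              = (x i.succ - (b i + c i) / 2) + (s - 1 / 2) * (b i - c i) := by ring
          have h6 : |b i - c i| ≤ 2 := by
            have h1 := abs_le.mp (hb i)
            have h2 := abs_le.mp (hc1 i)
            exact abs_le.mpr ⟨by linarith [h1.1, h2.2], by linarith [h1.2, h2.1]⟩
          have h7 : |(s - 1 / 2) * (b i - c i)| ≤ η / 12 * 2 := by
            rw [abs_mul]
            exact mul_le_mul hs h6 (abs_nonneg _) (by positivity)
          rw [h5]
          refine (abs_add_le _ _).trans ?_
          nlinarith
        have hmem := hQ (hbox x' hx'b) (hFQ hqF) (by linarith : 0 ≤ 1 - s)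
          (by linarith : 0 ≤ s) (by ring)
        convert hmem using 1
        rw [Fin.sum_univ_succ, hqu]
        simp only [Matrix.cons_val_zero, Matrix.cons_val_succ, ← hsdef, Finset.smul_sum,
          smul_add, smul_smul]
        rw [← add_assoc, ← Finset.sum_add_distrib, add_comm]
        congr 1
        refine Finset.sum_congr rfl fun i _ => ?_
        rw [← add_smul]
        congr 1
        have hLi := (hLpos i).ne'
        rw [hx', hc]
        field_simp
        ring

variable [FiniteDimensional ℝ E]

lemma isCompact_setOf_orthonormal (m : ℕ) : IsCompact {e : Fin m → E | Orthonormal ℝ e} := by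
  refine Metric.isCompact_of_isClosed_isBounded ?_ ?_
  · simp only [orthonormal_iff_ite, Set.ofPred_forall]
    refine isClosed_iInter fun i => isClosed_iInter fun j => ?_
    exact isClosed_eq (by fun_prop) continuous_const
  · refine (Metric.isBounded_closedBall (x := (0 : Fin m → E)) (r := 1)).subset fun e he => ?_
    rw [mem_closedBall_zero_iff, pi_norm_le_iff_of_nonneg zero_le_one]
    exact fun i => (he.norm_eq_one i).le

/-- A convex set is either close to a subspace of dimension `k - 1` or contains a large
`k`-dimensional cube. -/
lemma near_subspace_or_cube_subset (Q : Set E) (hQ : Convex ℝ Q) (hQ0 : (0 : E) ∈ Q)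
    {R : ℝ} (hR : 0 < R) (k : ℕ) (hk : 1 ≤ k) (hkE : k - 1 ≤ Module.finrank ℝ E) :
    (∃ S : Submodule ℝ E, Module.finrank ℝ S = k - 1 ∧ ∀ p ∈ Q, ∃ w ∈ S, ‖p - w‖ ≤ R) ∨
    ∃ (e : Fin k → E) (β : E), Orthonormal ℝ e ∧ β ∈ Q ∧
      ∀ y : Fin k → ℝ, (∀ i, |y i| ≤ (1 / 12) ^ k * R) → β + ∑ i, y i • e i ∈ Q := by
  by_cases hfin : ∀ F : Finset E, F.Nonempty → (F : Set E) ⊆ Q →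
      ∃ S : Submodule ℝ E, Module.finrank ℝ S < k ∧ ∀ p ∈ F, ∃ w ∈ S, ‖p - w‖ ≤ R
  · classical
    left
    have hfin' : ∀ F : Finset E, F.Nonempty → (F : Set E) ⊆ Q →
        ∃ e : Fin (k - 1) → E, Orthonormal ℝ e ∧ ∀ p ∈ F, ‖p - ∑ i, inner ℝ (e i) p • e i‖ ≤ R := by
      intro F hF hFQ
      obtain ⟨S, hSk, hS⟩ := hfin F hF hFQ
      obtain ⟨S', hSS', hS'⟩ := exists_submodule_finrank_eq S (k - 1) (by omega) hkE
      let bs := (stdOrthonormalBasis ℝ S').reindex (finCongr hS')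
      have he : Orthonormal ℝ (fun i => (bs i : E)) := bs.orthonormal.comp_linearIsometry S'.subtypeₗᵢ
      refine ⟨fun i => bs i, he, fun p hp => ?_⟩
      obtain ⟨w, hw, hwR⟩ := hS p hp
      refine le_trans ?_ hwR
      have hw' : w = ∑ i, inner ℝ (bs i : E) w • (bs i : E) := by
        have := bs.sum_repr' ⟨w, hSS' hw⟩
        have := congrArg (Subtype.val) this
        simpa using this.symm
      set r := p - ∑ i, inner ℝ (bs i : E) p • (bs i : E) with hr
      have h1 : p - w = r + ∑ i, (inner ℝ (bs i : E) p - inner ℝ (bs i : E) w) • (bs i : E) := by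
        simp only [sub_smul, Finset.sum_sub_distrib, ← hw', hr]
        abel
      have h2 : inner ℝ r (∑ i, (inner ℝ (bs i : E) p - inner ℝ (bs i : E) w) • (bs i : E)) = 0 := by
        rw [inner_sum]
        refine Finset.sum_eq_zero fun i _ => ?_
        have h4 : inner ℝ (bs i : E) r = 0 := by
          rw [hr, inner_sub_right]
          exact sub_eq_zero.mpr
            (he.inner_right_fintype (fun l => inner ℝ (bs l : E) p) i).symm
        rw [real_inner_smul_right, real_inner_comm (bs i : E) r, h4, mul_zero]
      rw [h1]
      have h3 := norm_add_sq_eq_norm_sq_add_norm_sq_real h2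
      by_contra! h5
      nlinarith [norm_nonneg (r + ∑ i, (inner ℝ (bs i : E) p - inner ℝ (bs i : E) w) • (bs i : E)),
        mul_self_nonneg ‖∑ i, (inner ℝ (bs i : E) p - inner ℝ (bs i : E) w) • (bs i : E)‖]
    obtain ⟨e, he, heQ⟩ := (isCompact_setOf_orthonormal (E := E) (k - 1)).inter_iInter_nonempty
      (fun p : Q => {e : Fin (k - 1) → E | ‖(p : E) - ∑ i, inner ℝ (e i) (p : E) • e i‖ ≤ R})
      (fun p => isClosed_le (by fun_prop) continuous_const) (by
        intro u
        obtain ⟨e, he, heF⟩ := hfin' (insert 0 (u.map ⟨Subtype.val, Subtype.val_injective⟩))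
          (Finset.insert_nonempty _ _) (by
            intro p hp
            simp only [Finset.coe_insert, Finset.coe_map, Set.mem_insert_iff] at hp
            rcases hp with rfl | ⟨p', _, rfl⟩
            · exact hQ0
            · exact p'.2)
        refine ⟨e, he, ?_⟩
        simp only [Set.mem_iInter]
        intro p hp
        exact heF p (Finset.mem_insert_of_mem (Finset.mem_map.mpr ⟨p, hp, rfl⟩)))
    refine ⟨Submodule.span ℝ (Set.range e), ?_, fun p hp => ⟨∑ i, inner ℝ (e i) p • e i, ?_, ?_⟩⟩
    · rw [finrank_span_eq_card he.linearIndependent, Fintype.card_fin]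
    · exact Submodule.sum_mem _ fun i _ => Submodule.smul_mem _ _ (Submodule.subset_span ⟨i, rfl⟩)
    · exact Set.mem_iInter.mp heQ ⟨p, hp⟩
  · right
    push Not at hfin
    obtain ⟨F, hF, hFQ, hFS⟩ := hfin
    rcases near_subspace_or_box_subset Q hQ hQ0 F hF hFQ hR k with
      ⟨S, _, hSk, hS⟩ | ⟨e, L, b, he, hL, _, _, hbox⟩
    · obtain ⟨p, hp, h⟩ := hFS S hSk
      obtain ⟨w, hw, hwR⟩ := hS p hp
      exact absurd hwR (not_le.mpr (h w hw))
    · refine ⟨e, ∑ i, (b i * L i) • e i, he, hbox b (fun i => by simp), fun y hy => ?_⟩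
      have hLpos : ∀ i, 0 < L i := fun i => hR.trans (hL i)
      have := hbox (fun i => b i + y i / L i) (fun i => by
        rw [add_sub_cancel_left, abs_div, abs_of_pos (hLpos i), div_le_iff₀ (hLpos i)]
        refine (hy i).trans ?_
        gcongr
        exact (hL i).le)
      convert this using 1
      rw [← Finset.sum_add_distrib]
      refine Finset.sum_congr rfl fun i _ => ?_
      rw [← add_smul]
      congr 1
      have := (hLpos i).ne'
      field_simp

end AlmostAffine

/-- The trace-zero hyperplane of `ℝⁿ` with its Euclidean structure. -/
def traceZero (n : ℕ) : Submodule ℝ (EuclideanSpace ℝ (Fin n)) :=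
  LinearMap.ker ((∑ i, LinearMap.proj i : (Fin n → ℝ) →ₗ[ℝ] ℝ) ∘ₗ
    (WithLp.linearEquiv 2 ℝ (Fin n → ℝ)).toLinearMap)

/-- The inclusion of the trace-zero hyperplane into `Fin n → ℝ`. -/
def traceZeroIncl (n : ℕ) : traceZero n →ₗ[ℝ] (Fin n → ℝ) :=
  (WithLp.linearEquiv 2 ℝ (Fin n → ℝ)).toLinearMap ∘ₗ (traceZero n).subtype

lemma traceZeroIncl_injective (n : ℕ) : Function.Injective (traceZeroIncl n) := by
  unfold traceZeroIncl
  rw [LinearMap.coe_comp]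
  exact (WithLp.linearEquiv 2 ℝ (Fin n → ℝ)).injective.comp (traceZero n).injective_subtype

lemma sum_traceZeroIncl {n : ℕ} (t : traceZero n) : ∑ i, traceZeroIncl n t i = 0 := by
  have := t.2
  have h2 : ∑ i, (t : EuclideanSpace ℝ (Fin n)).ofLp i = 0 := by simpa [traceZero] using this
  exact h2

lemma exists_traceZeroIncl_eq {n : ℕ} (t : Fin n → ℝ) (ht : ∑ i, t i = 0) :
    ∃ s, traceZeroIncl n s = t :=
  ⟨⟨WithLp.toLp 2 t, by simpa [traceZero] using ht⟩, rfl⟩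

lemma enorm_traceZeroIncl {n : ℕ} (t : traceZero n) : enorm (traceZeroIncl n t) = ‖t‖ := by
  change _ = ‖(t : EuclideanSpace ℝ (Fin n))‖
  rw [EuclideanSpace.norm_eq]
  simp [enorm, traceZeroIncl]

lemma finrank_traceZero (n : ℕ) : n - 1 ≤ Module.finrank ℝ (traceZero n) := by
  have h := LinearMap.finrank_range_add_finrank_ker
    ((∑ i, LinearMap.proj i : (Fin n → ℝ) →ₗ[ℝ] ℝ) ∘ₗ
      (WithLp.linearEquiv 2 ℝ (Fin n → ℝ)).toLinearMap)
  have h1 := Submodule.finrank_le (LinearMap.range ((∑ i, LinearMap.proj i : (Fin n → ℝ) →ₗ[ℝ] ℝ) ∘ₗ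
      (WithLp.linearEquiv 2 ℝ (Fin n → ℝ)).toLinearMap))
  rw [finrank_euclideanSpace_fin] at h
  rw [Module.finrank_self] at h1
  rw [traceZero]
  have key : ∀ a b : ℕ, a + b = n → a ≤ 1 → n - 1 ≤ b := by omega
  exact key _ _ h h1

/-- Right multiplication normalising the entries of a matrix by a maximal minor. -/
lemma exists_mul_right_entries_le_one {n k : ℕ} (B : Matrix (Fin n) (Fin k) ℝ)
    (hB : 0 < minorNorm B 0) :
    ∃ P : Matrix (Fin k) (Fin k) ℝ, (∀ i j, |(B * P) i j| ≤ 1) ∧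
      (minorNorm B 0)⁻¹ ≤ |P.det| ∧ |P.det| ≤ (n : ℝ) ^ k / minorNorm B 0 := by
  have h0 : ∃ σ : Fin k → Fin n, (B.submatrix σ id).det ≠ 0 := by
    by_contra! h
    simp [minorNorm, h] at hB
  obtain ⟨τ, hτ⟩ := h0
  have : Nonempty (Fin k → Fin n) := ⟨τ⟩
  obtain ⟨σ, hσ⟩ := Finite.exists_max fun σ : Fin k → Fin n => |(B.submatrix σ id).det|
  have hσ0 : 0 < |(B.submatrix σ id).det| := (abs_pos.mpr hτ).trans_le (hσ τ)
  have hdet : (B.submatrix σ id).det ≠ 0 := abs_pos.mp hσ0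
  have hunit : IsUnit (B.submatrix σ id).det := isUnit_iff_ne_zero.mpr hdet
  have hle : |(B.submatrix σ id).det| ≤ minorNorm B 0 := by
    simpa using exp_mul_minor_le_minorNorm B 0 σ
  have hge : minorNorm B 0 ≤ (n : ℝ) ^ k * |(B.submatrix σ id).det| := by
    have := Finset.sum_le_card_nsmul (Finset.univ : Finset (Fin k → Fin n))
      (fun σ => |(B.submatrix σ id).det|) _ fun τ _ => hσ τ
    simpa [minorNorm] using this
  have hPdet : |(B.submatrix σ id)⁻¹.det| = |(B.submatrix σ id).det|⁻¹ := by
    rw [Matrix.det_nonsing_inv, Ring.inverse_eq_inv', abs_inv]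
  refine ⟨(B.submatrix σ id)⁻¹, fun i j => ?_, ?_, ?_⟩
  · rw [Matrix.inv_def, Ring.inverse_eq_inv', Matrix.mul_smul, Matrix.smul_apply,
      mul_adjugate_submatrix_apply, smul_eq_mul, abs_mul, abs_inv, inv_mul_le_iff₀ hσ0, mul_one]
    exact hσ _
  · rw [hPdet]
    exact inv_anti₀ hσ0 hle
  · rw [hPdet, inv_eq_one_div, div_le_div_iff₀ hσ0 hB, one_mul]
    exact hge

/-- Compactness: there is a uniform bound on the size of the cubes on which `minorNorm` stays
bounded. -/
lemma exists_nat_not_minorNorm_bounded_on_cube {n k : ℕ} (hk : 0 < k) {c : ℝ} (hc : 0 < c)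
    (C : ℝ) :
    ∃ m : ℕ, ∀ e : Fin k → traceZero n, Orthonormal ℝ e → ∀ B : Matrix (Fin n) (Fin k) ℝ,
      (∀ i j, |B i j| ≤ 1) → (∀ t : Fin n → ℝ, ∑ i, t i = 0 → c ≤ minorNorm B t) →
      ¬ ∀ y : Fin k → ℝ, (∀ i, |y i| ≤ m) →
        minorNorm B (traceZeroIncl n (∑ i, y i • e i)) ≤ C := by
  by_contra! h
  let K : ℕ → Set ((Fin k → traceZero n) × (Fin n → Fin k → ℝ)) := fun m =>
    ({e | Orthonormal ℝ e} ×ˢ Set.Icc (-1) 1) ∩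
      ({p | ∀ t : Fin n → ℝ, ∑ i, t i = 0 → c ≤ minorNorm (Matrix.of p.2) t} ∩
      {p | ∀ y : Fin k → ℝ, (∀ i, |y i| ≤ m) →
        minorNorm (Matrix.of p.2) (traceZeroIncl n (∑ i, y i • p.1 i)) ≤ C})
  have hι : Continuous (traceZeroIncl n) := LinearMap.continuous_of_finiteDimensional _
  have hcl : ∀ m, IsClosed ({p : (Fin k → traceZero n) × (Fin n → Fin k → ℝ) |
      ∀ t : Fin n → ℝ, ∑ i, t i = 0 → c ≤ minorNorm (Matrix.of p.2) t} ∩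
      {p | ∀ y : Fin k → ℝ, (∀ i, |y i| ≤ m) →
        minorNorm (Matrix.of p.2) (traceZeroIncl n (∑ i, y i • p.1 i)) ≤ C}) := by
    intro m
    refine IsClosed.inter ?_ ?_
    · simp only [Set.ofPred_forall]
      refine isClosed_iInter fun t => isClosed_iInter fun _ =>
        isClosed_le continuous_const ?_
      exact continuous_minorNorm.comp (f := fun p : (Fin k → traceZero n) × (Fin n → Fin k → ℝ) =>
        (Matrix.of p.2, t)) (Continuous.prodMk continuous_snd continuous_const)
    · simp only [Set.ofPred_forall]
      refine isClosed_iInter fun y => isClosed_iInter fun _ =>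
        isClosed_le ?_ continuous_const
      refine continuous_minorNorm.comp (f := fun p : (Fin k → traceZero n) × (Fin n → Fin k → ℝ) =>
        (Matrix.of p.2, traceZeroIncl n (∑ i, y i • p.1 i))) (Continuous.prodMk continuous_snd ?_)
      exact hι.comp (by fun_prop)
  have hcomp : ∀ m, IsCompact (K m) := fun m =>
    ((isCompact_setOf_orthonormal (E := traceZero n) k).prod isCompact_Icc).inter_right (hcl m)
  obtain ⟨⟨e, B⟩, hp⟩ := IsCompact.nonempty_iInter_of_sequence_nonempty_isCompact_isClosed K
    (fun m p hp => ⟨hp.1, hp.2.1, fun y hy => hp.2.2 y fun i => (hy i).trans (by simp)⟩)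
    (fun m => by
      obtain ⟨e, he, B, hB, hlow, hup⟩ := h m
      exact ⟨(e, B), ⟨he, fun i j => (abs_le.mp (hB i j)).1, fun i j => (abs_le.mp (hB i j)).2⟩,
        hlow, hup⟩)
    (hcomp 0) (fun m => (hcomp m).isClosed)
  have hp := fun m => Set.mem_iInter.mp hp m
  have he : Orthonormal ℝ e := (hp 0).1.1
  refine false_of_minorNorm_bounded_on_flat hk (Matrix.of B) hc (hp 0).2.1
    (fun i => traceZeroIncl n (e i))
    (he.linearIndependent.map' _ (LinearMap.ker_eq_bot.mpr (traceZeroIncl_injective n)))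
    (C := C) fun y => ?_
  obtain ⟨m, hm⟩ := exists_nat_ge (∑ i, |y i|)
  have := (hp m).2.2 y fun i =>
    (Finset.single_le_sum (fun i _ => abs_nonneg (y i)) (Finset.mem_univ i)).trans hm
  simpa using this

/-- The sublevel sets of `minorNorm B` on the trace-zero hyperplane are uniformly almost affine of
dimension `k - 1`. -/
lemma exists_radius_minorNorm_sublevel {n k : ℕ} (hk : 1 ≤ k) (hkn : k ≤ n) {c C : ℝ} (hc : 0 < c)
    (hC : 0 < C) :
    ∃ R : ℝ, 0 < R ∧ ∀ B : Matrix (Fin n) (Fin k) ℝ,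
      (∀ t : Fin n → ℝ, ∑ i, t i = 0 → c ≤ minorNorm B t) →
      ∀ q₀ : Fin n → ℝ, ∑ i, q₀ i = 0 → minorNorm B q₀ ≤ C →
      ∃ W : Submodule ℝ (Fin n → ℝ), Module.finrank ℝ W = k - 1 ∧ (∀ w ∈ W, ∑ i, w i = 0) ∧
        ∀ b : Fin n → ℝ, ∑ i, b i = 0 → minorNorm B b ≤ C →
          ∃ w ∈ W, enorm (b - (q₀ + w)) ≤ R := by
  obtain ⟨m, hm⟩ := exists_nat_not_minorNorm_bounded_on_cube (n := n) (k := k) hk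
    (c := c / C) (by positivity) (C * ((n : ℝ) ^ k / c))
  refine ⟨12 ^ k * (m + 1), by positivity, fun B hlow q₀ hq₀ hq₀C => ?_⟩
  have hconv : Convex ℝ {t : traceZero n | minorNorm B (q₀ + traceZeroIncl n t) ≤ C} := by
    have h1 : Convex ℝ {t : Fin n → ℝ | minorNorm B (q₀ + t) ≤ C} := by
      have := ((convexOn_minorNorm B).convex_le C).translate_preimage_right q₀
      simpa only [Set.mem_univ, true_and, Set.preimage_ofPred_eq] using this
    exact h1.linear_preimage (traceZeroIncl n)
  rcases near_subspace_or_cube_subset _ hconv (by simpa using hq₀C)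
    (by positivity : (0 : ℝ) < 12 ^ k * (m + 1)) k hk
    ((Nat.sub_le_sub_right hkn 1).trans (finrank_traceZero n)) with
    ⟨S, hS, hnear⟩ | ⟨e, β, he, -, hcube⟩
  · refine ⟨S.map (traceZeroIncl n), ?_, ?_, fun b hb hbC => ?_⟩
    · rw [← hS]
      exact (Submodule.equivMapOfInjective _ (traceZeroIncl_injective n) S).finrank_eq.symm
    · rintro _ ⟨w, -, rfl⟩
      exact sum_traceZeroIncl w
    · obtain ⟨p, hp⟩ := exists_traceZeroIncl_eq (b - q₀) (by simp [hb, hq₀])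
      obtain ⟨w, hw, hwR⟩ := hnear p (by simpa [hp] using hbC)
      refine ⟨traceZeroIncl n w, ⟨w, hw, rfl⟩, ?_⟩
      rw [← sub_sub, ← hp, ← map_sub, enorm_traceZeroIncl]
      exact hwR
  · exfalso
    set B' := Matrix.diagonal (fun i => Real.exp ((q₀ + traceZeroIncl n β) i)) * B with hB'
    have hB't : ∀ t, minorNorm B' t = minorNorm B (q₀ + traceZeroIncl n β + t) :=
      fun t => minorNorm_diagonal_mul B _ t
    have hlow' : ∀ t : Fin n → ℝ, ∑ i, t i = 0 → c ≤ minorNorm B' t := fun t ht => by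
      rw [hB't]
      exact hlow _ (by simp [Finset.sum_add_distrib, hq₀, sum_traceZeroIncl, ht])
    have hup' : ∀ y : Fin k → ℝ, (∀ i, |y i| ≤ m) →
        minorNorm B' (traceZeroIncl n (∑ i, y i • e i)) ≤ C := fun y hy => by
      rw [hB't, add_assoc, ← map_add]
      refine hcube y fun i => (hy i).trans ?_
      rw [← mul_assoc, ← mul_pow]
      norm_num
    have h0 : c ≤ minorNorm B' 0 := hlow' 0 (by simp)
    have h0C : minorNorm B' 0 ≤ C := by simpa using hup' 0 (by simp)
    obtain ⟨P, hP1, hPlow, hPup⟩ := exists_mul_right_entries_le_one B' (hc.trans_le h0)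
    refine hm e he (B' * P) hP1 (fun t ht => ?_) (fun y hy => ?_)
    · rw [minorNorm_mul_right, div_eq_mul_inv]
      exact mul_le_mul (hlow' t ht) ((inv_anti₀ (hc.trans_le h0) h0C).trans hPlow)
        (by positivity) (minorNorm_nonneg _ _)
    · rw [minorNorm_mul_right]
      refine mul_le_mul (hup' y hy) (hPup.trans ?_) (abs_nonneg _) hC.le
      gcongr

lemma mem_latticeOf {n : ℕ} {h : Matrix (Fin n) (Fin n) ℝ} {v : Fin n → ℝ} :
    v ∈ latticeOf h ↔ ∃ m : Fin n → ℤ, h *ᵥ (fun i => (m i : ℝ)) = v := by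
  constructor
  · intro hv
    refine AddSubgroup.closure_induction (p := fun v _ => ∃ m : Fin n → ℤ,
      h *ᵥ (fun i => (m i : ℝ)) = v) ?_ ?_ ?_ ?_ hv
    · rintro _ ⟨m, rfl⟩
      exact ⟨m, rfl⟩
    · exact ⟨0, by simp [← Pi.zero_def]⟩
    · rintro _ _ _ _ ⟨m, rfl⟩ ⟨m', rfl⟩
      exact ⟨m + m', by rw [← Matrix.mulVec_add]; congr 1; ext i; simp⟩
    · rintro _ _ ⟨m, rfl⟩
      exact ⟨-m, by rw [← Matrix.mulVec_neg]; congr 1; ext i; simp⟩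
  · rintro ⟨m, rfl⟩
    exact AddSubgroup.subset_closure ⟨m, rfl⟩

lemma mapLat_mapLat {n : ℕ} (a b : Matrix (Fin n) (Fin n) ℝ) (L : AddSubgroup (Fin n → ℝ)) :
    mapLat a (mapLat b L) = mapLat (a * b) L := by
  unfold mapLat
  rw [AddSubgroup.map_map]
  congr 1
  ext v
  simp

lemma mapLat_one {n : ℕ} (L : AddSubgroup (Fin n → ℝ)) : mapLat 1 L = L := by
  ext v
  simp [mapLat, AddSubgroup.mem_map]

lemma mapLat_latticeOf {n : ℕ} (a g : Matrix (Fin n) (Fin n) ℝ) :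
    mapLat a (latticeOf g) = latticeOf (a * g) := by
  ext v
  simp only [mapLat, AddSubgroup.mem_map, mem_latticeOf]
  constructor
  · rintro ⟨_, ⟨m, rfl⟩, rfl⟩
    exact ⟨m, by simp⟩
  · rintro ⟨m, rfl⟩
    exact ⟨_, ⟨m, rfl⟩, by simp⟩

lemma latticeOf_mul_le {n : ℕ} (g γ : Matrix (Fin n) (Fin n) ℝ) (hγ : γ ∈ Gam n) :
    latticeOf (g * γ) ≤ latticeOf g := by
  intro v
  simp only [mem_latticeOf]
  rintro ⟨m, rfl⟩
  choose z hz using hγ.2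
  refine ⟨fun i => ∑ j, z i j * m j, ?_⟩
  rw [← Matrix.mulVec_mulVec]
  congr 1
  ext i
  simp [Matrix.mulVec, dotProduct, hz]

lemma inv_mem_Gam {n : ℕ} {γ : Matrix (Fin n) (Fin n) ℝ} (hγ : γ ∈ Gam n) : γ⁻¹ ∈ Gam n := by
  obtain ⟨hdet, hzint⟩ := hγ
  choose z hz using hzint
  refine ⟨by rw [Matrix.det_nonsing_inv, hdet, Ring.inverse_one], fun i j => ?_⟩
  have h1 : γ = (Matrix.of z).map (Int.castRingHom ℝ) := by
    ext i j
    simp [hz]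
  refine ⟨(Matrix.of z).adjugate i j, ?_⟩
  rw [Matrix.inv_def, hdet, Ring.inverse_one, one_smul, h1]
  have := (Int.castRingHom ℝ).map_adjugate (Matrix.of z)
  have := congrFun (congrFun this i) j
  simpa using this.symm

lemma latticeOf_mul_Gam {n : ℕ} (g γ : Matrix (Fin n) (Fin n) ℝ) (hγ : γ ∈ Gam n) :
    latticeOf (g * γ) = latticeOf g := by
  refine le_antisymm (latticeOf_mul_le g γ hγ) ?_
  have := latticeOf_mul_le (g * γ) γ⁻¹ (inv_mem_Gam hγ)
  rwa [Matrix.mul_assoc, Matrix.mul_nonsing_inv _ (by rw [hγ.1]; exact isUnit_one),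
    Matrix.mul_one] at this

lemma span_closure_range {n r : ℕ} (v : Fin r → Fin n → ℝ) :
    Submodule.span ℝ (AddSubgroup.closure (Set.range v) : Set (Fin n → ℝ))
      = Submodule.span ℝ (Set.range v) := by
  refine le_antisymm (Submodule.span_le.mpr ?_) (Submodule.span_mono AddSubgroup.subset_closure)
  have : AddSubgroup.closure (Set.range v) ≤ (Submodule.span ℝ (Set.range v)).toAddSubgroup :=
    (AddSubgroup.closure_le _).mpr Submodule.subset_span
  exact this

lemma rk_closure_range {n r : ℕ} {v : Fin r → Fin n → ℝ} (hv : LinearIndependent ℝ v) :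
    rk (AddSubgroup.closure (Set.range v)) = r := by
  rw [rk, span_closure_range, finrank_span_eq_card hv, Fintype.card_fin]

/-- A subgroup of a lattice has a `ℤ`-basis which is linearly independent over `ℝ`. -/
lemma exists_basis_of_le_latticeOf {n : ℕ} {h : Matrix (Fin n) (Fin n) ℝ} (hdet : h.det ≠ 0)
    {Λ : AddSubgroup (Fin n → ℝ)} (hΛ : Λ ≤ latticeOf h) :
    ∃ (r : ℕ) (v : Fin r → Fin n → ℝ), LinearIndependent ℝ v ∧
      Λ = AddSubgroup.closure (Set.range v) := by
  let φ : (Fin n → ℤ) →+ (Fin n → ℝ) :=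
    (Matrix.mulVecLin h).toAddMonoidHom.comp
      { toFun := fun m i => (m i : ℝ), map_zero' := by ext; simp, map_add' := by intros; ext; simp }
  have hφ : ∀ m, φ m = h *ᵥ (fun i => (m i : ℝ)) := fun m => rfl
  let N : Submodule ℤ (Fin n → ℤ) :=
    { carrier := {m | φ m ∈ Λ}
      add_mem' := fun {a b} ha hb => by
        change φ (a + b) ∈ Λ
        rw [map_add]
        exact Λ.add_mem ha hb
      zero_mem' := by
        change φ 0 ∈ Λ
        rw [map_zero]
        exact Λ.zero_mem
      smul_mem' := fun c m hm => by
        change φ (c • m) ∈ Λ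
        rw [map_zsmul]
        exact Λ.zsmul_mem hm c }
  obtain ⟨r, ⟨bs⟩⟩ := Submodule.nonempty_basis_of_pid (Pi.basisFun ℤ (Fin n)) N
  have hli : LinearIndependent ℤ (N.subtype ∘ bs) :=
    bs.linearIndependent.map' N.subtype (Submodule.ker_subtype N)
  have hspan : Submodule.span ℤ (Set.range fun i => (bs i : Fin n → ℤ)) = N := by
    have := congrArg (Submodule.map N.subtype) bs.span_eq
    rw [Submodule.map_span, Submodule.map_subtype_top, ← Set.range_comp] at this
    exact this
  refine ⟨r, fun i => φ (bs i), ?_, ?_⟩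
  · have hli2 : LinearIndependent ℝ fun i => (fun j => ((bs i : Fin n → ℤ) j : ℝ)) := by
      exact linearIndependent_algebraMap_comp_iff (R := ℤ) (S := ℝ).mpr hli
    exact hli2.map' (Matrix.mulVecLin h) (LinearMap.ker_eq_bot.mpr
      (Matrix.mulVec_injective_of_det_ne_zero hdet))
  · refine le_antisymm (fun v hv => ?_) ((AddSubgroup.closure_le _).mpr ?_)
    · obtain ⟨m, rfl⟩ := mem_latticeOf.mp (hΛ hv)
      have hm : m ∈ Submodule.span ℤ (Set.range fun i => (bs i : Fin n → ℤ)) := by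
        rw [hspan]
        exact hv
      obtain ⟨c, rfl⟩ := (Submodule.mem_span_range_iff_exists_fun ℤ).mp hm
      rw [← hφ, map_sum]
      refine AddSubgroup.sum_mem _ fun i _ => ?_
      rw [map_zsmul]
      exact AddSubgroup.zsmul_mem _ (AddSubgroup.subset_closure (Set.mem_range_self i)) _
    · rintro _ ⟨i, rfl⟩
      exact (bs i).2

/-- The matrix whose columns are the vectors of a family. -/
def colMat {n k : ℕ} (v : Fin k → Fin n → ℝ) : Matrix (Fin n) (Fin k) ℝ := (Matrix.of v)ᵀ

lemma factorial_mul_gvol_sq {n k : ℕ} (v : Fin k → Fin n → ℝ) :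
    (k.factorial : ℝ) * gvol v ^ 2 = ∑ σ : Fin k → Fin n, ((colMat v).submatrix σ id).det ^ 2 := by
  have hG : (Matrix.of fun i j => einner (v i) (v j)) = (colMat v)ᵀ * colMat v := by
    ext i j
    simp [einner, colMat, Matrix.mul_apply]
  have h := factorial_mul_det_transpose_mul (colMat v)
  have hk : (0 : ℝ) < k.factorial := by positivity
  have h0 : 0 ≤ ((colMat v)ᵀ * colMat v).det := by
    refine le_of_mul_le_mul_left ?_ hk
    rw [mul_zero, h]
    positivity
  rw [gvol, hG, Real.sq_sqrt h0, h]

lemma abs_det_submatrix_le_gvol {n k : ℕ} (v : Fin k → Fin n → ℝ) (σ : Fin k → Fin n) :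
    |((colMat v).submatrix σ id).det| ≤ k.factorial * gvol v := by
  have h1 := Finset.single_le_sum
    (f := fun σ : Fin k → Fin n => ((colMat v).submatrix σ id).det ^ 2)
    (fun τ _ => sq_nonneg _) (Finset.mem_univ σ)
  rw [← factorial_mul_gvol_sq] at h1
  have hk : (1 : ℝ) ≤ k.factorial := by exact_mod_cast k.factorial_pos
  have h0 : 0 ≤ gvol v := Real.sqrt_nonneg _
  refine abs_le_of_sq_le_sq (h1.trans ?_) (by positivity)
  rw [mul_pow]
  gcongr
  nlinarith

lemma minorNorm_colMat_le {n k : ℕ} (v : Fin k → Fin n → ℝ) :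
    minorNorm (colMat v) 0 ≤ (n : ℝ) ^ k * (k.factorial * gvol v) := by
  have := Finset.sum_le_card_nsmul (Finset.univ : Finset (Fin k → Fin n))
    (fun σ => |((colMat v).submatrix σ id).det|) _ fun τ _ => abs_det_submatrix_le_gvol v τ
  simpa [minorNorm] using this

lemma exists_int_matrix_of_mem_latticeOf {n k : ℕ} {h : Matrix (Fin n) (Fin n) ℝ}
    {v : Fin k → Fin n → ℝ} (hv : ∀ j, v j ∈ latticeOf h) :
    ∃ Z : Matrix (Fin n) (Fin k) ℤ, colMat v = h * Z.map (Int.castRingHom ℝ) := by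
  choose m hm using fun j => mem_latticeOf.mp (hv j)
  refine ⟨Matrix.of fun i j => m j i, ?_⟩
  ext i j
  simp [colMat, ← hm j, Matrix.mulVec, dotProduct, Matrix.mul_apply]

lemma abs_det_submatrix_mul_le {n k : ℕ} {h : Matrix (Fin n) (Fin n) ℝ} {M : ℝ}
    (hM : ∀ i j, |h i j| ≤ M) (B : Matrix (Fin n) (Fin k) ℝ) (σ : Fin k → Fin n) :
    |((h * B).submatrix σ id).det| ≤ M ^ k * minorNorm B 0 := by
  rw [det_submatrix_mul_eq_sum]
  refine (Finset.abs_sum_le_sum_abs _ _).trans ?_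
  simp only [minorNorm, Pi.zero_apply, Finset.sum_const_zero, Real.exp_zero, one_mul,
    Finset.mul_sum]
  refine Finset.sum_le_sum fun τ _ => ?_
  rw [abs_mul]
  gcongr
  rw [Finset.abs_prod]
  refine (Finset.prod_le_prod (fun _ _ => abs_nonneg _) fun i _ => hM _ _).trans ?_
  simp

lemma det_submatrix_map_intCast {n k : ℕ} (Z : Matrix (Fin n) (Fin k) ℤ) (σ : Fin k → Fin n) :
    ((Z.map (Int.castRingHom ℝ)).submatrix σ id).det = ((Z.submatrix σ id).det : ℝ) := by
  have := (Int.castRingHom ℝ).map_det (Z.submatrix σ id)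
  rw [RingHom.mapMatrix_apply, ← Matrix.submatrix_map] at this
  exact this.symm

lemma exists_int_minor_ne_zero {n k : ℕ} {h : Matrix (Fin n) (Fin n) ℝ}
    {v : Fin k → Fin n → ℝ} (hli : LinearIndependent ℝ v) {Z : Matrix (Fin n) (Fin k) ℤ}
    (hZ : colMat v = h * Z.map (Int.castRingHom ℝ)) :
    ∃ σ : Fin k → Fin n, (Z.submatrix σ id).det ≠ 0 := by
  by_contra! h0
  obtain ⟨σ, hσ⟩ := exists_det_submatrix_ne_zero (colMat v) hli
  refine hσ ?_
  rw [hZ, det_submatrix_mul_eq_sum]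
  exact Finset.sum_eq_zero fun τ _ => by
    rw [det_submatrix_map_intCast, h0, Int.cast_zero, mul_zero]

lemma inv_le_minorNorm_colMat {n k : ℕ} {h : Matrix (Fin n) (Fin n) ℝ} (hdet : h.det ≠ 0) {M : ℝ}
    (hM0 : 0 < M) (hM : ∀ i j, |h⁻¹ i j| ≤ M) {v : Fin k → Fin n → ℝ}
    (hli : LinearIndependent ℝ v) (hv : ∀ j, v j ∈ latticeOf h) :
    (M ^ k)⁻¹ ≤ minorNorm (colMat v) 0 := by
  obtain ⟨Z, hZ⟩ := exists_int_matrix_of_mem_latticeOf hv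
  obtain ⟨σ, hσ⟩ := exists_int_minor_ne_zero hli hZ
  have h1 := abs_det_submatrix_mul_le hM (colMat v) σ
  rw [hZ, Matrix.nonsing_inv_mul_cancel_left _ _ (isUnit_iff_ne_zero.mpr hdet),
    det_submatrix_map_intCast, ← hZ] at h1
  have h2 : (1 : ℝ) ≤ |((Z.submatrix σ id).det : ℝ)| := by
    exact_mod_cast Int.one_le_abs hσ
  rw [inv_le_iff_one_le_mul₀ (by positivity), mul_comm]
  exact h2.trans h1

/-- A subgroup of bounded covolume in a lattice contains linearly independent vectors of bounded
size spanning the same subspace. -/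
lemma exists_bounded_spanning {n k : ℕ} {h : Matrix (Fin n) (Fin n) ℝ} (hdet : h.det ≠ 0) {M : ℝ}
    (hM0 : 0 < M) (hM : ∀ i j, |h i j| ≤ M) (hM' : ∀ i j, |h⁻¹ i j| ≤ M) {v : Fin k → Fin n → ℝ}
    (hli : LinearIndependent ℝ v) (hv : ∀ j, v j ∈ latticeOf h) :
    ∃ u : Fin k → Fin n → ℝ, (∀ j, u j ∈ AddSubgroup.closure (Set.range v)) ∧
      (∀ j i, |u j i| ≤ n * (M * (M ^ k * ((n : ℝ) ^ k * (k.factorial * gvol v))))) ∧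
      Submodule.span ℝ (Set.range v) ≤ Submodule.span ℝ (Set.range u) := by
  obtain ⟨Z, hZ⟩ := exists_int_matrix_of_mem_latticeOf hv
  obtain ⟨σ, hσ⟩ := exists_int_minor_ne_zero hli hZ
  have hZ' : Z.map (Int.castRingHom ℝ) = h⁻¹ * colMat v := by
    rw [hZ, Matrix.nonsing_inv_mul_cancel_left _ _ (isUnit_iff_ne_zero.mpr hdet)]
  set A : Matrix (Fin k) (Fin k) ℤ := (Z.submatrix σ id).adjugate with hA
  have hu : ∀ j i, (∑ l, A l j • v l) i = (colMat v * A.map (Int.castRingHom ℝ)) i j := by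
    intro j i
    simp [Matrix.mul_apply, colMat, mul_comm]
  refine ⟨fun j => ∑ l, A l j • v l, fun j => AddSubgroup.sum_mem _ fun l _ =>
    AddSubgroup.zsmul_mem _ (AddSubgroup.subset_closure (Set.mem_range_self l)) _, fun j i => ?_, ?_⟩
  · have hmin : ∀ l, |((Z * A).map (Int.castRingHom ℝ)) l j|
        ≤ M ^ k * ((n : ℝ) ^ k * (k.factorial * gvol v)) := by
      intro l
      rw [Matrix.map_apply, hA, mul_adjugate_submatrix_apply, eq_intCast,
        ← det_submatrix_map_intCast, hZ']
      refine (abs_det_submatrix_mul_le hM' _ _).trans ?_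
      gcongr
      exact minorNorm_colMat_le v
    have h1 : colMat v * A.map (Int.castRingHom ℝ) = h * (Z * A).map (Int.castRingHom ℝ) := by
      rw [hZ, Matrix.map_mul, Matrix.mul_assoc]
    change |(∑ l, A l j • v l) i| ≤ _
    rw [hu j i, h1, Matrix.mul_apply]
    refine (Finset.abs_sum_le_sum_abs _ _).trans ?_
    refine (Finset.sum_le_card_nsmul _ _ _ fun l _ => ?_).trans_eq
      (by rw [Finset.card_univ, Fintype.card_fin, nsmul_eq_mul])
    rw [abs_mul]
    exact mul_le_mul (hM _ _) (hmin l) (abs_nonneg _) hM0.le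
  · rw [Submodule.span_le]
    rintro _ ⟨l, rfl⟩
    have hdet0 : ((Z.submatrix σ id).det : ℝ) ≠ 0 := by exact_mod_cast hσ
    have h1 : ((Z.submatrix σ id).det : ℝ) • v l
        = ∑ j, ((Z.submatrix σ id j l : ℤ) : ℝ) • ∑ l', A l' j • v l' := by
      have h2 : ∀ l', ∑ j, A l' j * Z.submatrix σ id j l
          = if l' = l then (Z.submatrix σ id).det else 0 := by
        intro l'
        have := congrFun (congrFun (Matrix.adjugate_mul (Z.submatrix σ id)) l') l
        rw [Matrix.mul_apply, Matrix.smul_apply, Matrix.one_apply] at this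
        simpa using this
      simp only [Finset.smul_sum]
      rw [Finset.sum_comm]
      have h3 : ∀ l', (∑ j, ((Z.submatrix σ id j l : ℤ) : ℝ) • A l' j • v l')
          = (((∑ j, A l' j * Z.submatrix σ id j l : ℤ)) : ℝ) • v l' := by
        intro l'
        rw [Int.cast_sum, Finset.sum_smul]
        refine Finset.sum_congr rfl fun j _ => ?_
        rw [← Int.cast_smul_eq_zsmul ℝ (A l' j), smul_smul, Int.cast_mul, mul_comm]
      simp only [h3, h2]
      simp
    have h4 : v l = ((Z.submatrix σ id).det : ℝ)⁻¹ • (((Z.submatrix σ id).det : ℝ) • v l) := by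
      rw [smul_smul, inv_mul_cancel₀ hdet0, one_smul]
    rw [SetLike.mem_coe, h4, h1]
    exact Submodule.smul_mem _ _ (Submodule.sum_mem _ fun j _ =>
      Submodule.smul_mem _ _ (Submodule.subset_span ⟨j, rfl⟩))

lemma covol_nonneg {n : ℕ} (Λ : AddSubgroup (Fin n → ℝ)) : 0 ≤ covol Λ :=
  Real.sInf_nonneg fun _ ⟨_, _, _, _, hc⟩ => hc ▸ Real.sqrt_nonneg _

lemma alpha_nonneg {n : ℕ} (x : AddSubgroup (Fin n → ℝ)) : 0 ≤ alpha x :=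
  Real.sInf_nonneg fun _ ⟨Λ, _, _, hc⟩ => hc ▸ Real.rpow_nonneg (covol_nonneg Λ) _

lemma alpha_le {n : ℕ} {x Λ : AddSubgroup (Fin n → ℝ)} (hΛ : Λ ≤ x) (hΛ0 : Λ ≠ ⊥) :
    alpha x ≤ covol Λ ^ ((rk Λ : ℝ)⁻¹) :=
  csInf_le ⟨0, fun _ ⟨Λ, _, _, hc⟩ => hc ▸ Real.rpow_nonneg (covol_nonneg Λ) _⟩
    ⟨Λ, hΛ, hΛ0, rfl⟩

lemma covol_closure_le_gvol {n r : ℕ} {v : Fin r → Fin n → ℝ} (hv : LinearIndependent ℝ v) :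
    covol (AddSubgroup.closure (Set.range v)) ≤ gvol v :=
  csInf_le ⟨0, fun _ ⟨_, _, _, _, hc⟩ => hc ▸ Real.sqrt_nonneg _⟩ ⟨r, v, hv, rfl, rfl⟩

lemma latticeOf_eq_closure_col {n : ℕ} (h : Matrix (Fin n) (Fin n) ℝ) :
    latticeOf h = AddSubgroup.closure (Set.range h.col) := by
  refine le_antisymm (fun v hv => ?_) ((AddSubgroup.closure_le _).mpr ?_)
  · obtain ⟨m, rfl⟩ := mem_latticeOf.mp hv
    rw [Matrix.mulVec_eq_sum]
    refine AddSubgroup.sum_mem _ fun j _ => ?_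
    have : MulOpposite.op (m j : ℝ) • hᵀ j = m j • h.col j := by
      ext i
      simp [mul_comm]
    rw [this]
    exact AddSubgroup.zsmul_mem _ (AddSubgroup.subset_closure (Set.mem_range_self j)) _
  · rintro _ ⟨j, rfl⟩
    refine mem_latticeOf.mpr ⟨Pi.single j 1, ?_⟩
    ext i
    simp [Matrix.mulVec, dotProduct, Pi.single_apply]

lemma linearIndependent_col {n : ℕ} {h : Matrix (Fin n) (Fin n) ℝ} (hdet : h.det ≠ 0) :
    LinearIndependent ℝ h.col :=
  Matrix.linearIndependent_cols_of_det_ne_zero hdet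

lemma latticeOf_ne_bot {n : ℕ} (hn : 0 < n) {h : Matrix (Fin n) (Fin n) ℝ} (hdet : h.det ≠ 0) :
    latticeOf h ≠ ⊥ := by
  intro h0
  have h1 : h.col ⟨0, hn⟩ ∈ latticeOf h := by
    rw [latticeOf_eq_closure_col]
    exact AddSubgroup.subset_closure (Set.mem_range_self _)
  rw [h0, AddSubgroup.mem_bot] at h1
  exact (linearIndependent_col hdet).ne_zero _ h1

lemma alpha_latticeOf_le_one {n : ℕ} (hn : 0 < n) {h : Matrix (Fin n) (Fin n) ℝ}
    (hdet : h.det = 1) : alpha (latticeOf h) ≤ 1 := by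
  have hdet0 : h.det ≠ 0 := by rw [hdet]; exact one_ne_zero
  refine (alpha_le le_rfl (latticeOf_ne_bot hn hdet0)).trans ?_
  refine Real.rpow_le_one (covol_nonneg _) ?_ (by positivity)
  rw [latticeOf_eq_closure_col]
  refine (covol_closure_le_gvol (linearIndependent_col hdet0)).trans_eq ?_
  have hG : (Matrix.of fun i j => einner (h.col i) (h.col j)) = hᵀ * h := by
    ext i j
    simp [einner, Matrix.mul_apply]
  rw [gvol, hG, Matrix.det_mul, Matrix.det_transpose, hdet]
  simp

/-- Nearly minimal subgroups of a unimodular lattice have bases of bounded covolume. -/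
lemma exists_basis_of_mem_MinSet {n : ℕ} (hn : 0 < n) {h : Matrix (Fin n) (Fin n) ℝ}
    (hdet : h.det = 1) {δ D : ℝ} (hδ : 0 ≤ 1 + δ) (hD : 0 ≤ D) (hδD : δ ≤ D)
    {Λ : AddSubgroup (Fin n → ℝ)} (hΛ : Λ ∈ MinSet δ (latticeOf h)) :
    ∃ (r : ℕ) (v : Fin r → Fin n → ℝ), r ≤ n ∧ LinearIndependent ℝ v ∧
      Λ = AddSubgroup.closure (Set.range v) ∧ gvol v ≤ (1 + D) ^ n := by
  obtain ⟨hle, hne, hlt⟩ := hΛ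
  obtain ⟨r, v, hv, hΛv⟩ := exists_basis_of_le_latticeOf (by rw [hdet]; exact one_ne_zero) hle
  have hr : rk Λ = r := by rw [hΛv, rk_closure_range hv]
  have hr0 : r ≠ 0 := by
    rintro rfl
    apply hne
    rw [hΛv, Set.range_eq_empty, AddSubgroup.closure_empty]
  have hrn : r ≤ n := by
    have := hv.fintype_card_le_finrank
    simpa using this
  have h1 : covol Λ ^ ((r : ℝ)⁻¹) < 1 + D := by
    rw [hr] at hlt
    have := mul_le_of_le_one_right hδ (alpha_latticeOf_le_one hn hdet)
    linarith
  have h2 : covol Λ < (1 + D) ^ n := by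
    rw [← Real.rpow_inv_natCast_pow (covol_nonneg Λ) hr0]
    refine (pow_lt_pow_left₀ h1 (Real.rpow_nonneg (covol_nonneg Λ) _) hr0).trans_le ?_
    exact pow_le_pow_right₀ (by linarith) hrn
  obtain ⟨_, ⟨r', v', hv', hΛv', rfl⟩, hlt'⟩ := exists_lt_of_csInf_lt
    (⟨gvol v, r, v, hv, hΛv, rfl⟩ : {c | covolSpec Λ c}.Nonempty) h2
  have hr' : r' = r := by rw [← hr, hΛv', rk_closure_range hv']
  exact ⟨r', v', by omega, hv', hΛv', hlt'.le⟩

/-- `V_δ` of a lattice in a compact family is spanned by bounded lattice vectors. -/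
lemma Vdelta_le_span_bounded {n : ℕ} (hn : 0 < n) {h : Matrix (Fin n) (Fin n) ℝ}
    (hdet : h.det = 1) {M : ℝ} (hM1 : 1 ≤ M) (hM : ∀ i j, |h i j| ≤ M)
    (hM' : ∀ i j, |h⁻¹ i j| ≤ M) {δ D : ℝ} (hδ : 0 ≤ 1 + δ) (hD : 0 ≤ D) (hδD : δ ≤ D) :
    Vdelta δ (latticeOf h) ≤ Submodule.span ℝ
      {u | u ∈ latticeOf h ∧ u ∈ Vdelta δ (latticeOf h) ∧
        ∀ i, |u i| ≤ n * (M * (M ^ n * ((n : ℝ) ^ n * (n.factorial * (1 + D) ^ n))))} := by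
  refine Submodule.span_le.mpr (Set.iUnion₂_subset fun Λ hΛ => ?_)
  obtain ⟨r, v, hrn, hv, hΛv, hvol⟩ := exists_basis_of_mem_MinSet hn hdet hδ hD hδD hΛ
  have hΛV : (Λ : Set (Fin n → ℝ)) ⊆ Vdelta δ (latticeOf h) :=
    (Set.subset_biUnion_of_mem (u := fun Λ : AddSubgroup (Fin n → ℝ) => (Λ : Set (Fin n → ℝ)))
      hΛ).trans Submodule.subset_span
  obtain ⟨u, hu, hub, hspan⟩ := exists_bounded_spanning (by rw [hdet]; exact one_ne_zero)
    (zero_lt_one.trans_le hM1) hM hM' hv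
    (fun j => hΛ.1 (hΛv ▸ AddSubgroup.subset_closure (Set.mem_range_self j)))
  have hn1 : (1 : ℝ) ≤ n := by exact_mod_cast hn
  have hu' : Set.range u ⊆ {u | u ∈ latticeOf h ∧ u ∈ Vdelta δ (latticeOf h) ∧
        ∀ i, |u i| ≤ n * (M * (M ^ n * ((n : ℝ) ^ n * (n.factorial * (1 + D) ^ n))))} := by
    rintro _ ⟨j, rfl⟩
    have huΛ : u j ∈ Λ := hΛv ▸ hu j
    refine ⟨hΛ.1 huΛ, hΛV huΛ, fun i => (hub j i).trans ?_⟩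
    have : (r.factorial : ℝ) ≤ n.factorial := by exact_mod_cast Nat.factorial_le hrn
    have : 0 ≤ gvol v := Real.sqrt_nonneg _
    gcongr
  have h1 : (Λ : Set (Fin n → ℝ)) ⊆ Submodule.span ℝ (Set.range v) := by
    rw [← span_closure_range, ← hΛv]
    exact Submodule.subset_span
  exact h1.trans (hspan.trans (Submodule.span_mono hu'))

/-- The diagonal matrix with logarithmic coordinates `t`. -/
def expDiag {n : ℕ} (t : Fin n → ℝ) : Matrix (Fin n) (Fin n) ℝ :=
  Matrix.diagonal fun i => Real.exp (t i)

lemma expDiag_zero {n : ℕ} : expDiag (0 : Fin n → ℝ) = 1 := by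
  simp [expDiag]

lemma expDiag_add {n : ℕ} (s t : Fin n → ℝ) : expDiag (s + t) = expDiag s * expDiag t := by
  simp [expDiag, Real.exp_add, Matrix.diagonal_mul_diagonal]

lemma det_expDiag {n : ℕ} {t : Fin n → ℝ} (ht : ∑ i, t i = 0) : (expDiag t).det = 1 := by
  rw [expDiag, Matrix.det_diagonal, ← Real.exp_sum, ht, Real.exp_zero]

lemma expDiag_mulVec_apply {n : ℕ} (t v : Fin n → ℝ) (i : Fin n) :
    (expDiag t *ᵥ v) i = Real.exp (t i) * v i := by
  rw [expDiag, Matrix.mulVec_diagonal]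

lemma expDiag_mulVecLin_injective {n : ℕ} (t : Fin n → ℝ) :
    Function.Injective (expDiag t).mulVecLin := by
  intro v w hvw
  ext i
  have := congrFun hvw i
  simp only [Matrix.mulVecLin_apply, expDiag_mulVec_apply] at this
  exact mul_left_cancel₀ (Real.exp_pos _).ne' this

lemma linearIndependent_expDiag {n r : ℕ} (t : Fin n → ℝ) {v : Fin r → Fin n → ℝ}
    (hv : LinearIndependent ℝ v) : LinearIndependent ℝ fun j => expDiag t *ᵥ v j :=
  hv.map' (expDiag t).mulVecLin (LinearMap.ker_eq_bot.mpr (expDiag_mulVecLin_injective t))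

lemma colMat_expDiag {n r : ℕ} (t : Fin n → ℝ) (v : Fin r → Fin n → ℝ) :
    colMat (fun j => expDiag t *ᵥ v j) = expDiag t * colMat v := by
  ext i j
  simp [colMat, expDiag, Matrix.mulVec_diagonal, Matrix.diagonal_mul]

lemma mapLat_closure_range {n r : ℕ} (a : Matrix (Fin n) (Fin n) ℝ) (v : Fin r → Fin n → ℝ) :
    mapLat a (AddSubgroup.closure (Set.range v))
      = AddSubgroup.closure (Set.range fun j => a *ᵥ v j) := by
  unfold mapLat
  rw [AddMonoidHom.map_closure, ← Set.range_comp]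
  rfl

lemma gvol_expDiag_le {n r : ℕ} {t : Fin n → ℝ} {η : ℝ} (ht : ∀ i, t i ≤ η)
    (v : Fin r → Fin n → ℝ) : gvol (fun j => expDiag t *ᵥ v j) ≤ Real.exp η ^ r * gvol v := by
  have h0 : 0 ≤ gvol v := Real.sqrt_nonneg _
  refine le_of_sq_le_sq ?_ (by positivity)
  have hr : (0 : ℝ) < r.factorial := by positivity
  refine le_of_mul_le_mul_left ?_ hr
  rw [factorial_mul_gvol_sq, mul_pow, mul_left_comm, factorial_mul_gvol_sq, Finset.mul_sum]
  refine Finset.sum_le_sum fun σ _ => ?_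
  have h1 : ((colMat fun j => expDiag t *ᵥ v j).submatrix σ id).det
      = (∏ i, Real.exp (t (σ i))) * ((colMat v).submatrix σ id).det := by
    rw [← Matrix.det_mul_column]
    congr 1
    ext i j
    simp [colMat, expDiag_mulVec_apply]
  rw [h1, mul_pow]
  gcongr
  refine (Finset.prod_le_prod (fun _ _ => (Real.exp_pos _).le)
    fun i _ => Real.exp_le_exp.mpr (ht (σ i))).trans ?_
  simp

/-- Effect of a small diagonal matrix on the normalised covolume. -/
lemma covol_rpow_mapLat_expDiag_le {n : ℕ} {h : Matrix (Fin n) (Fin n) ℝ} (hdet : h.det ≠ 0)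
    {t : Fin n → ℝ} {η : ℝ} (ht : ∀ i, t i ≤ η) {Λ : AddSubgroup (Fin n → ℝ)}
    (hΛ : Λ ≤ latticeOf h) (hΛ0 : Λ ≠ ⊥) :
    covol (mapLat (expDiag t) Λ) ^ ((rk (mapLat (expDiag t) Λ) : ℝ)⁻¹)
      ≤ Real.exp η * covol Λ ^ ((rk Λ : ℝ)⁻¹) := by
  obtain ⟨r, v, hv, hΛv⟩ := exists_basis_of_le_latticeOf hdet hΛ
  have hr0 : r ≠ 0 := by
    rintro rfl
    apply hΛ0
    rw [hΛv, Set.range_eq_empty, AddSubgroup.closure_empty]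
  have hr : rk Λ = r := by rw [hΛv, rk_closure_range hv]
  have hr' : rk (mapLat (expDiag t) Λ) = r := by
    rw [hΛv, mapLat_closure_range, rk_closure_range (linearIndependent_expDiag t hv)]
  have hcov : covol (mapLat (expDiag t) Λ) ≤ Real.exp η ^ r * covol Λ := by
    have hE : 0 < Real.exp η ^ r := by positivity
    rw [mul_comm, ← div_le_iff₀ hE]
    refine le_csInf ⟨_, r, v, hv, hΛv, rfl⟩ ?_
    rintro _ ⟨r', v', hv', hΛv', rfl⟩
    have hrr : r' = r := by rw [← hr, hΛv', rk_closure_range hv']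
    subst hrr
    rw [div_le_iff₀ hE, mul_comm, hΛv', mapLat_closure_range]
    exact (covol_closure_le_gvol (linearIndependent_expDiag t hv')).trans (gvol_expDiag_le ht v')
  rw [hr, hr']
  refine (Real.rpow_le_rpow (covol_nonneg _) hcov (by positivity)).trans_eq ?_
  rw [Real.mul_rpow (by positivity) (covol_nonneg _), Real.pow_rpow_inv_natCast (by positivity) hr0]

lemma mapLat_mono {n : ℕ} (a : Matrix (Fin n) (Fin n) ℝ) {L L' : AddSubgroup (Fin n → ℝ)}
    (h : L ≤ L') : mapLat a L ≤ mapLat a L' := AddSubgroup.map_mono h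

lemma mapLat_expDiag_ne_bot {n : ℕ} (t : Fin n → ℝ) {Λ : AddSubgroup (Fin n → ℝ)} (h : Λ ≠ ⊥) :
    mapLat (expDiag t) Λ ≠ ⊥ := by
  intro h0
  have h1 : mapLat (expDiag (-t)) (mapLat (expDiag t) Λ) = Λ := by
    rw [mapLat_mapLat, ← expDiag_add, neg_add_cancel, expDiag_zero, mapLat_one]
  rw [h0] at h1
  exact h (h1.symm.trans (AddSubgroup.map_bot _))

lemma alpha_le_exp_mul_alpha_mapLat {n : ℕ} (hn : 0 < n) {h : Matrix (Fin n) (Fin n) ℝ}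
    (hdet : h.det ≠ 0) {t : Fin n → ℝ} {η : ℝ} (ht : ∀ i, |t i| ≤ η) :
    alpha (latticeOf h) ≤ Real.exp η * alpha (mapLat (expDiag t) (latticeOf h)) := by
  have hback : mapLat (expDiag (-t)) (mapLat (expDiag t) (latticeOf h)) = latticeOf h := by
    rw [mapLat_mapLat, ← expDiag_add, neg_add_cancel, expDiag_zero, mapLat_one]
  have hdet' : (expDiag t * h).det ≠ 0 := by
    rw [Matrix.det_mul, expDiag, Matrix.det_diagonal]
    exact mul_ne_zero (Finset.prod_ne_zero_iff.mpr fun i _ => (Real.exp_pos _).ne') hdet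
  rw [mul_comm, ← div_le_iff₀ (Real.exp_pos η)]
  refine le_csInf ⟨_, _, le_rfl, mapLat_expDiag_ne_bot t (latticeOf_ne_bot hn hdet), rfl⟩ ?_
  rintro _ ⟨Λ, hΛ, hΛ0, rfl⟩
  rw [div_le_iff₀ (Real.exp_pos η), mul_comm]
  refine (alpha_le (Λ := mapLat (expDiag (-t)) Λ) ((mapLat_mono _ hΛ).trans_eq hback)
    (mapLat_expDiag_ne_bot _ hΛ0)).trans ?_
  rw [mapLat_latticeOf] at hΛ
  exact covol_rpow_mapLat_expDiag_le hdet' (fun i => (neg_le_abs (t i)).trans (ht i)) hΛ hΛ0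

lemma map_Vdelta_le {n : ℕ} (hn : 0 < n) {h : Matrix (Fin n) (Fin n) ℝ}
    (hdet : h.det ≠ 0) {t : Fin n → ℝ} {η δ δ' : ℝ} (ht : ∀ i, |t i| ≤ η) (hδ : 0 ≤ 1 + δ)
    (hδ' : Real.exp η * Real.exp η * (1 + δ) ≤ 1 + δ') :
    (Vdelta δ (latticeOf h)).map (expDiag t).mulVecLin
      ≤ Vdelta δ' (mapLat (expDiag t) (latticeOf h)) := by
  unfold Vdelta
  rw [Submodule.map_span, Submodule.span_le, Set.image_iUnion₂]
  refine Set.iUnion₂_subset fun Λ hΛ => ?_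
  obtain ⟨hle, hne, hlt⟩ := hΛ
  have hmem : mapLat (expDiag t) Λ ∈ MinSet δ' (mapLat (expDiag t) (latticeOf h)) := by
    refine ⟨mapLat_mono _ hle, mapLat_expDiag_ne_bot t hne, ?_⟩
    refine (covol_rpow_mapLat_expDiag_le hdet (fun i => (le_abs_self _).trans (ht i)) hle
      hne).trans_lt ?_
    refine (mul_lt_mul_of_pos_left hlt (Real.exp_pos η)).trans_le ?_
    calc Real.exp η * ((1 + δ) * alpha (latticeOf h))
        ≤ Real.exp η * ((1 + δ) *
          (Real.exp η * alpha (mapLat (expDiag t) (latticeOf h)))) := by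
          gcongr
          exact alpha_le_exp_mul_alpha_mapLat hn hdet ht
      _ = Real.exp η * Real.exp η * (1 + δ) * alpha (mapLat (expDiag t) (latticeOf h)) := by ring
      _ ≤ _ := by
          gcongr
          exact alpha_nonneg _
  exact (Set.subset_biUnion_of_mem
    (u := fun Λ : AddSubgroup (Fin n → ℝ) => (Λ : Set (Fin n → ℝ))) hmem).trans
      Submodule.subset_span

lemma expDiag_mem_Apos {n : ℕ} {t : Fin n → ℝ} (ht : ∑ i, t i = 0) : expDiag t ∈ Apos n :=
  ⟨_, fun i => Real.exp_pos (t i), by rw [← Real.exp_sum, ht, Real.exp_zero], rfl⟩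

lemma expDiag_logCoord {n : ℕ} {a : Matrix (Fin n) (Fin n) ℝ} (ha : a ∈ Apos n) :
    expDiag (logCoord a) = a := by
  obtain ⟨d, hd, -, rfl⟩ := ha
  simp [expDiag, logCoord, Real.exp_log (hd _)]

lemma sum_logCoord {n : ℕ} {a : Matrix (Fin n) (Fin n) ℝ} (ha : a ∈ Apos n) :
    ∑ i, logCoord a i = 0 := by
  obtain ⟨d, hd, hprod, rfl⟩ := ha
  simp only [logCoord, Matrix.diagonal_apply_eq]
  rw [← Real.log_prod fun i _ => (hd i).ne', hprod, Real.log_one]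

lemma exists_bound_of_HasBoundedAOrbit {n : ℕ} {g : Matrix (Fin n) (Fin n) ℝ} (hg : g.det = 1)
    (hb : HasBoundedAOrbit g) :
    ∃ M : ℝ, 1 ≤ M ∧ ∀ t : Fin n → ℝ, ∑ i, t i = 0 → ∃ h : Matrix (Fin n) (Fin n) ℝ,
      h.det = 1 ∧ latticeOf h = mapLat (expDiag t) (latticeOf g) ∧
      (∀ i j, |h i j| ≤ M) ∧ ∀ i j, |h⁻¹ i j| ≤ M := by
  obtain ⟨K, hK, hKg⟩ := hb
  have hcont : Continuous fun h : Matrix (Fin n) (Fin n) ℝ =>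
      ∑ i, ∑ j, (|h i j| + |h.adjugate i j|) := by
    refine continuous_finsetSum _ fun i _ => continuous_finsetSum _ fun j _ => ?_
    exact (continuous_id.matrix_elem i j).abs.add
      (continuous_id.matrix_adjugate.matrix_elem i j).abs
  obtain ⟨M, hM⟩ := hK.bddAbove_image hcont.continuousOn
  refine ⟨max M 1, le_max_right _ _, fun t ht => ?_⟩
  obtain ⟨γ, hγ, hmem⟩ := hKg _ (expDiag_mem_Apos ht)
  have hdet : (expDiag t * g * γ).det = 1 := by
    rw [Matrix.det_mul, Matrix.det_mul, det_expDiag ht, hg, hγ.1, one_mul, one_mul]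
  have hle : ∀ i j, |(expDiag t * g * γ) i j| + |(expDiag t * g * γ).adjugate i j| ≤ M := by
    intro i j
    refine le_trans ?_ (hM ⟨_, hmem, rfl⟩)
    refine le_trans ?_ (Finset.single_le_sum (f := fun i => ∑ j,
      (|(expDiag t * g * γ) i j| + |(expDiag t * g * γ).adjugate i j|))
      (fun i _ => by positivity) (Finset.mem_univ i))
    exact Finset.single_le_sum (f := fun j =>
      |(expDiag t * g * γ) i j| + |(expDiag t * g * γ).adjugate i j|)
      (fun j _ => by positivity) (Finset.mem_univ j)
  refine ⟨expDiag t * g * γ, hdet, ?_, fun i j => ?_, fun i j => ?_⟩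
  · rw [latticeOf_mul_Gam _ _ hγ, mapLat_latticeOf]
  · exact le_max_of_le_left ((le_add_of_nonneg_right (abs_nonneg _)).trans (hle i j))
  · rw [Matrix.inv_def, hdet, Ring.inverse_one, one_smul]
    exact le_max_of_le_left ((le_add_of_nonneg_left (abs_nonneg _)).trans (hle i j))

lemma Vdelta_mono {n : ℕ} {δ δ' : ℝ} (h : δ ≤ δ') (x : AddSubgroup (Fin n → ℝ)) :
    Vdelta δ x ≤ Vdelta δ' x := by
  refine Submodule.span_mono (Set.biUnion_subset_biUnion_left fun Λ hΛ => ?_)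
  obtain ⟨hle, hne, hlt⟩ := hΛ
  refine ⟨hle, hne, hlt.trans_le ?_⟩
  gcongr
  exact alpha_nonneg x

lemma map_expDiag_map_expDiag {n : ℕ} (s t : Fin n → ℝ) (V : Submodule ℝ (Fin n → ℝ)) :
    (V.map (expDiag t).mulVecLin).map (expDiag s).mulVecLin
      = V.map (expDiag (s + t)).mulVecLin := by
  rw [← Submodule.map_comp, expDiag_add, Matrix.mulVecLin_mul]

lemma finrank_map_expDiag {n : ℕ} (t : Fin n → ℝ) (V : Submodule ℝ (Fin n → ℝ)) :
    Module.finrank ℝ (V.map (expDiag t).mulVecLin) = Module.finrank ℝ V :=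
  (Submodule.equivMapOfInjective _ (expDiag_mulVecLin_injective t) V).finrank_eq.symm

/-- `V_{kε}(a_t x)` pulled back by the diagonal matrix `a_t` with logarithmic coordinates `t`. -/
def pulledBackV {n : ℕ} (x : AddSubgroup (Fin n → ℝ)) (δ : ℝ) (t : Fin n → ℝ) :
    Submodule ℝ (Fin n → ℝ) :=
  (Vdelta δ (mapLat (expDiag t) x)).map (expDiag (-t)).mulVecLin

lemma map_pulledBackV {n : ℕ} (x : AddSubgroup (Fin n → ℝ)) (δ : ℝ) (t : Fin n → ℝ) :
    (pulledBackV x δ t).map (expDiag t).mulVecLin = Vdelta δ (mapLat (expDiag t) x) := by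
  rw [pulledBackV, map_expDiag_map_expDiag, add_neg_cancel, expDiag_zero, Matrix.mulVecLin_one,
    Submodule.map_id]

lemma mem_logCoord_image_Uset {n k : ℕ} {x : AddSubgroup (Fin n → ℝ)} {ε : ℝ} {t : Fin n → ℝ}
    (ht : t ∈ logCoord '' Uset x ε k) : ∑ i, t i = 0 ∧
      ∀ᶠ δ in 𝓝 ((k : ℝ) * ε), dimdelta δ (mapLat (expDiag t) x) = k := by
  obtain ⟨a, ⟨ha, s, hs, hdim⟩, rfl⟩ := ht
  refine ⟨sum_logCoord ha, ?_⟩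
  rw [expDiag_logCoord ha]
  exact Filter.mem_of_superset hs hdim

lemma finrank_pulledBackV {n k : ℕ} {x : AddSubgroup (Fin n → ℝ)} {ε : ℝ} {t : Fin n → ℝ}
    (ht : t ∈ logCoord '' Uset x ε k) : Module.finrank ℝ (pulledBackV x (k * ε) t) = k := by
  rw [pulledBackV, finrank_map_expDiag]
  exact (mem_logCoord_image_Uset ht).2.self_of_nhds

lemma continuousWithinAt_pulledBackV {n k : ℕ} (hn : 0 < n) (hk : 0 < k)
    {g : Matrix (Fin n) (Fin n) ℝ} (hg : g.det = 1) {ε : ℝ} (hε : 0 < ε) {t : Fin n → ℝ}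
    (ht : t ∈ logCoord '' Uset (latticeOf g) ε k) :
    ∀ᶠ t' in 𝓝[logCoord '' Uset (latticeOf g) ε k] t,
      pulledBackV (latticeOf g) (k * ε) t' = pulledBackV (latticeOf g) (k * ε) t := by
  have hkε : 0 < (k : ℝ) * ε := by positivity
  obtain ⟨hsum, hdim⟩ := mem_logCoord_image_Uset ht
  obtain ⟨δ, hδdim, hδ0, hδlt⟩ := ((hdim.filter_mono nhdsWithin_le_nhds).and
    (Ioo_mem_nhdsLT hkε)).exists
  have hVeq : Vdelta δ (mapLat (expDiag t) (latticeOf g))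
      = Vdelta (k * ε) (mapLat (expDiag t) (latticeOf g)) :=
    Submodule.eq_of_le_of_finrank_eq (Vdelta_mono hδlt.le _)
      (hδdim.trans hdim.self_of_nhds.symm)
  have hratio : 1 < (1 + k * ε) / (1 + δ) := by
    rw [one_lt_div (by linarith)]
    linarith
  set η := Real.log ((1 + k * ε) / (1 + δ)) / 2 with hη
  have hη0 : 0 < η := half_pos (Real.log_pos hratio)
  have hηexp : Real.exp η * Real.exp η * (1 + δ) ≤ 1 + k * ε := by
    rw [← Real.exp_add, hη, add_halves, Real.exp_log (zero_lt_one.trans hratio),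
      div_mul_cancel₀ _ (by linarith)]
  have hball : ∀ᶠ t' in 𝓝[logCoord '' Uset (latticeOf g) ε k] t, ‖t' - t‖ < η := by
    refine Filter.Eventually.filter_mono nhdsWithin_le_nhds ?_
    have := Metric.ball_mem_nhds t hη0
    filter_upwards [this] with t' ht'
    rwa [← dist_eq_norm]
  filter_upwards [hball, self_mem_nhdsWithin] with t' hclose ht'
  have hdet : (expDiag t * g).det ≠ 0 := by
    rw [Matrix.det_mul, det_expDiag hsum, hg, one_mul]
    exact one_ne_zero
  have hmap := map_Vdelta_le hn hdet (t := t' - t) (δ := δ) (δ' := k * ε)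
    (fun i => (norm_le_pi_norm (t' - t) i).trans hclose.le) (by linarith) hηexp
  rw [← mapLat_latticeOf, mapLat_mapLat, ← expDiag_add, sub_add_cancel, hVeq] at hmap
  have heq := Submodule.eq_of_le_of_finrank_eq hmap (by
    rw [finrank_map_expDiag]
    exact hdim.self_of_nhds.trans (mem_logCoord_image_Uset ht').2.self_of_nhds.symm)
  rw [pulledBackV, ← heq, map_expDiag_map_expDiag, pulledBackV]
  congr 3
  abel

lemma pulledBackV_eq_of_mem_connectedComponentIn {n k : ℕ} (hn : 0 < n) (hk : 0 < k)
    {g : Matrix (Fin n) (Fin n) ℝ} (hg : g.det = 1) {ε : ℝ} (hε : 0 < ε) {t₀ t : Fin n → ℝ}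
    (ht₀ : t₀ ∈ logCoord '' Uset (latticeOf g) ε k)
    (ht : t ∈ connectedComponentIn (logCoord '' Uset (latticeOf g) ε k) t₀) :
    pulledBackV (latticeOf g) (k * ε) t = pulledBackV (latticeOf g) (k * ε) t₀ := by
  let _ : TopologicalSpace (Submodule ℝ (Fin n → ℝ)) := ⊥
  have _ : DiscreteTopology (Submodule ℝ (Fin n → ℝ)) := ⟨rfl⟩
  refine isPreconnected_connectedComponentIn.constant (fun s hs => ?_) ht
    (mem_connectedComponentIn ht₀)
  have hs' := connectedComponentIn_subset _ _ hs
  refine ContinuousWithinAt.mono ?_ (connectedComponentIn_subset _ _)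
  exact continuousWithinAt_const.congr_of_eventuallyEq
    (continuousWithinAt_pulledBackV hn hk hg hε hs') rfl

lemma minorNorm_colMat_expDiag {n k : ℕ} (t : Fin n → ℝ) (v : Fin k → Fin n → ℝ) :
    minorNorm (colMat fun j => expDiag t *ᵥ v j) 0 = minorNorm (colMat v) t := by
  rw [colMat_expDiag, expDiag, minorNorm_diagonal_mul, add_zero]

lemma minorNorm_le_of_abs_le {n k : ℕ} {B : Matrix (Fin n) (Fin k) ℝ} {C : ℝ}
    (hB : ∀ i j, |B i j| ≤ C) : minorNorm B 0 ≤ (n : ℝ) ^ k * (k.factorial * C ^ k) := by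
  have h1 : ∀ σ : Fin k → Fin n, |(B.submatrix σ id).det| ≤ k.factorial * C ^ k := by
    intro σ
    have := Matrix.det_le (A := B.submatrix σ id) (abv := AbsoluteValue.abs) (x := C)
      fun i j => hB _ _
    simpa using this
  have := Finset.sum_le_card_nsmul (Finset.univ : Finset (Fin k → Fin n))
    (fun σ => |(B.submatrix σ id).det|) _ fun τ _ => h1 τ
  simpa [minorNorm] using this

/-- The passage from a linearly independent family in the `ℤ`-span of `v` to `v` itself does not
increase `minorNorm`. -/
lemma minorNorm_le_of_mem_closure {n k : ℕ} {v u : Fin k → Fin n → ℝ} {t : Fin n → ℝ}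
    (hu : LinearIndependent ℝ u)
    (huv : ∀ j, u j ∈ AddSubgroup.closure (Set.range v)) :
    minorNorm (colMat v) t ≤ minorNorm (colMat u) t := by
  have h1 : ∀ j, ∃ P : Fin k → ℤ, ∑ l, P l • v l = u j := fun j => by
    have := huv j
    rw [← Submodule.span_int_eq_addSubgroupClosure] at this
    exact (Submodule.mem_span_range_iff_exists_fun ℤ).mp this
  choose P hP using h1
  have hmat : colMat u = colMat v * ((Matrix.of P)ᵀ).map (Int.castRingHom ℝ) := by
    ext i j
    simp [colMat, ← hP, Matrix.mul_apply, mul_comm]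
  have hdet : ((((Matrix.of P)ᵀ).map (Int.castRingHom ℝ)).det) = ((Matrix.of P)ᵀ.det : ℝ) :=
    ((Int.castRingHom ℝ).map_det _).symm
  have hP0 : (Matrix.of P)ᵀ.det ≠ 0 := by
    intro h0
    obtain ⟨σ, hσ⟩ := exists_det_submatrix_ne_zero (colMat u) hu
    rw [hmat, det_submatrix_mul_right, hdet, h0, Int.cast_zero, mul_zero] at hσ
    exact hσ rfl
  rw [hmat, minorNorm_mul_right, hdet]
  refine le_mul_of_one_le_right (minorNorm_nonneg _ _) ?_
  exact_mod_cast Int.one_le_abs hP0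

/-- Every component of `U_k` is contained in a sublevel set of some `minorNorm B` which is
bounded below on the trace-zero hyperplane, with uniform constants. -/
lemma exists_minorNorm_bounds {n k : ℕ} (hn : 0 < n) (hk : 0 < k)
    {g : Matrix (Fin n) (Fin n) ℝ} (hg : g.det = 1) (hb : HasBoundedAOrbit g)
    {ε : ℝ} (hε : 0 < ε) :
    ∃ c C : ℝ, 0 < c ∧ 0 < C ∧ ∀ t₀ ∈ logCoord '' Uset (latticeOf g) ε k,
      ∃ B : Matrix (Fin n) (Fin k) ℝ, (∀ t : Fin n → ℝ, ∑ i, t i = 0 → c ≤ minorNorm B t) ∧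
        ∀ t ∈ connectedComponentIn (logCoord '' Uset (latticeOf g) ε k) t₀,
          minorNorm B t ≤ C := by
  obtain ⟨M, hM1, hM⟩ := exists_bound_of_HasBoundedAOrbit hg hb
  have hM0 : 0 < M := zero_lt_one.trans_le hM1
  have hn0 : (0 : ℝ) < n := by exact_mod_cast hn
  have hkε : 0 ≤ (k : ℝ) * ε := by positivity
  set C₂ : ℝ := n * (M * (M ^ n * ((n : ℝ) ^ n * (n.factorial * (1 + k * ε) ^ n)))) with hC₂
  have hC₂0 : 0 < C₂ := by positivity
  refine ⟨(M ^ k)⁻¹, (n : ℝ) ^ k * (k.factorial * C₂ ^ k), by positivity, by positivity,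
    fun t₀ ht₀ => ?_⟩
  have hg0 : g.det ≠ 0 := by rw [hg]; exact one_ne_zero
  set V := pulledBackV (latticeOf g) (k * ε) t₀ with hV
  have hVk : Module.finrank ℝ V = k := finrank_pulledBackV ht₀
  obtain ⟨r, v, hv, hΛv⟩ := exists_basis_of_le_latticeOf hg0
    (inf_le_left : latticeOf g ⊓ V.toAddSubgroup ≤ latticeOf g)
  -- bounded vectors spanning `a_t V`
  have hspan : ∀ t ∈ connectedComponentIn (logCoord '' Uset (latticeOf g) ε k) t₀,
      V.map (expDiag t).mulVecLin ≤ Submodule.span ℝ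
        {u | expDiag (-t) *ᵥ u ∈ AddSubgroup.closure (Set.range v) ∧ ∀ i, |u i| ≤ C₂} := by
    intro t ht
    have ht' := connectedComponentIn_subset _ _ ht
    obtain ⟨h, hdet, hlat, hhM, hhM'⟩ := hM t (mem_logCoord_image_Uset ht').1
    rw [hV, ← pulledBackV_eq_of_mem_connectedComponentIn hn hk hg hε ht₀ ht, map_pulledBackV,
      ← hlat]
    refine (Vdelta_le_span_bounded hn hdet hM1 hhM hhM' (by linarith) hkε le_rfl).trans
      (Submodule.span_mono ?_)
    rintro u ⟨hul, huV, hub⟩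
    refine ⟨?_, hub⟩
    rw [← hΛv]
    constructor
    · have h1 : expDiag (-t) *ᵥ u ∈ mapLat (expDiag (-t)) (latticeOf h) := ⟨u, hul, rfl⟩
      rwa [hlat, mapLat_mapLat, ← expDiag_add, neg_add_cancel, expDiag_zero, mapLat_one] at h1
    · rw [hlat] at huV
      have h1 : expDiag (-t) *ᵥ u ∈ pulledBackV (latticeOf g) (k * ε) t := ⟨u, huV, rfl⟩
      rwa [pulledBackV_eq_of_mem_connectedComponentIn hn hk hg hε ht₀ ht] at h1
  have hback : ∀ t (u : Fin n → ℝ), expDiag t *ᵥ (expDiag (-t) *ᵥ u) = u := fun t u => by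
    rw [Matrix.mulVec_mulVec, ← expDiag_add, add_neg_cancel, expDiag_zero, Matrix.one_mulVec]
  have hle : ∀ t, Submodule.span ℝ
      {u : Fin n → ℝ | expDiag (-t) *ᵥ u ∈ AddSubgroup.closure (Set.range v) ∧ ∀ i, |u i| ≤ C₂}
        ≤ (Submodule.span ℝ (Set.range v)).map (expDiag t).mulVecLin := by
    intro t
    refine Submodule.span_le.mpr ?_
    rintro u ⟨hu, -⟩
    refine ⟨expDiag (-t) *ᵥ u, ?_, hback t u⟩
    rw [← span_closure_range]
    exact Submodule.subset_span hu
  have hvV : Submodule.span ℝ (Set.range v) ≤ V := by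
    rw [← span_closure_range, ← hΛv]
    exact Submodule.span_le.mpr fun u hu => hu.2
  have hspan_eq : ∀ t ∈ connectedComponentIn (logCoord '' Uset (latticeOf g) ε k) t₀,
      Module.finrank ℝ (Submodule.span ℝ
        {u : Fin n → ℝ | expDiag (-t) *ᵥ u ∈ AddSubgroup.closure (Set.range v) ∧
          ∀ i, |u i| ≤ C₂}) = k := by
    intro t ht
    rw [← hVk, ← finrank_map_expDiag t V, ((hle t).trans (Submodule.map_mono hvV)).antisymm
      (hspan t ht)]
  have hrk : r = k := by
    have h1 := Submodule.finrank_mono (hle t₀)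
    have h2 := Submodule.finrank_mono hvV
    rw [hspan_eq t₀ (mem_connectedComponentIn ht₀), finrank_map_expDiag,
      finrank_span_eq_card hv, Fintype.card_fin] at h1
    rw [finrank_span_eq_card hv, Fintype.card_fin, hVk] at h2
    omega
  subst hrk
  refine ⟨colMat v, fun t ht => ?_, fun t ht => ?_⟩
  · obtain ⟨h, hdet, hlat, -, hhM'⟩ := hM t ht
    rw [← minorNorm_colMat_expDiag]
    refine inv_le_minorNorm_colMat (by rw [hdet]; exact one_ne_zero) hM0 hhM'
      (linearIndependent_expDiag t hv) fun j => ?_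
    rw [hlat]
    refine ⟨v j, ?_, rfl⟩
    have hj : v j ∈ latticeOf g ⊓ V.toAddSubgroup := by
      rw [hΛv]
      exact AddSubgroup.subset_closure (Set.mem_range_self j)
    exact hj.1
  · obtain ⟨f, hf, -, hfli⟩ := Submodule.exists_fun_fin_finrank_span_eq ℝ
      {u : Fin n → ℝ | expDiag (-t) *ᵥ u ∈ AddSubgroup.closure (Set.range v) ∧
        ∀ i, |u i| ≤ C₂}
    have hcard := hspan_eq t ht
    have hu : LinearIndependent ℝ (f ∘ Fin.cast hcard.symm) :=
      hfli.comp _ (Fin.cast_injective _)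
    set u := f ∘ Fin.cast hcard.symm with hu_def
    have hfu : ∀ j, expDiag (-t) *ᵥ u j ∈ AddSubgroup.closure (Set.range v) ∧
      ∀ i, |u j i| ≤ C₂ := fun j => hf _
    have h1 : minorNorm (colMat u) 0 = minorNorm (colMat fun j => expDiag (-t) *ᵥ u j) t := by
      rw [← minorNorm_colMat_expDiag t, funext fun j => hback t (u j)]
    refine (minorNorm_le_of_mem_closure (linearIndependent_expDiag (-t) hu)
      fun j => (hfu j).1).trans ?_
    rw [← h1]
    exact minorNorm_le_of_abs_le fun i j => (hfu j).2 i

lemma exists_radius_Uset_component {n k : ℕ} (hn : 0 < n) (hk : 1 ≤ k) (hkn : k ≤ n)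
    {g : Matrix (Fin n) (Fin n) ℝ} (hg : g.det = 1) (hb : HasBoundedAOrbit g) {ε : ℝ}
    (hε : 0 < ε) :
    ∃ R : ℝ, 0 < R ∧ ∀ t₀ ∈ logCoord '' Uset (latticeOf g) ε k,
      ∃ W : Submodule ℝ (Fin n → ℝ),
        Module.finrank ℝ W = k - 1 ∧ (∀ w ∈ W, ∑ i, w i = 0) ∧
        ∀ b ∈ connectedComponentIn (logCoord '' Uset (latticeOf g) ε k) t₀,
          ∃ w ∈ W, enorm (b - (t₀ + w)) ≤ R := by
  obtain ⟨c, C, hc, hC, hB⟩ := exists_minorNorm_bounds (k := k) hn hk hg hb hε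
  obtain ⟨R, hR, hsub⟩ := exists_radius_minorNorm_sublevel hk hkn hc hC
  refine ⟨R, hR, fun t₀ ht₀ => ?_⟩
  obtain ⟨B, hBc, hBC⟩ := hB t₀ ht₀
  obtain ⟨W, hWk, hW0, hW⟩ := hsub B hBc t₀ (mem_logCoord_image_Uset ht₀).1
    (hBC t₀ (mem_connectedComponentIn ht₀))
  exact ⟨W, hWk, hW0, fun b hbt => hW b
    (mem_logCoord_image_Uset (connectedComponentIn_subset _ _ hbt)).1 (hBC b hbt)⟩

end SW

/-- **Lemma 3.5.** For `x ∈ ℒ_n` with bounded `A`-orbit and `ε ∈ (0,1)` there is `R > 0` such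
that every connected component of `U_k^{x,ε}` is `(R, k-1)`-almost affine: in logarithmic
coordinates it lies within distance `R` of a translate of a `(k-1)`-dimensional linear
subspace of the trace-zero hyperplane. -/
theorem SW.Uk_components_almost_affine (n : ℕ) (hn : 0 < n)
    (g : Matrix (Fin n) (Fin n) ℝ) (hg : g.det = 1) (hb : SW.HasBoundedAOrbit g)
    (ε : ℝ) (hε : ε ∈ Set.Ioo (0 : ℝ) 1) :
    ∃ R : ℝ, 0 < R ∧ ∀ k : ℕ, 1 ≤ k → k ≤ n →
      ∀ a ∈ SW.Uset (SW.latticeOf g) ε k,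
        ∃ (W : Submodule ℝ (Fin n → ℝ)) (v₀ : Fin n → ℝ),
          Module.finrank ℝ W = k - 1 ∧ (∀ w ∈ W, (∑ i, w i) = 0) ∧
          ∀ b ∈ connectedComponentIn (SW.logCoord '' SW.Uset (SW.latticeOf g) ε k)
              (SW.logCoord a),
            ∃ w ∈ W, SW.enorm (b - (v₀ + w)) ≤ R := by
  have hex : ∀ k : ℕ, ∃ R : ℝ, 0 < R ∧ (1 ≤ k → k ≤ n →
      ∀ t₀ ∈ SW.logCoord '' SW.Uset (SW.latticeOf g) ε k,
        ∃ W : Submodule ℝ (Fin n → ℝ),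
          Module.finrank ℝ W = k - 1 ∧ (∀ w ∈ W, ∑ i, w i = 0) ∧
          ∀ b ∈ connectedComponentIn (SW.logCoord '' SW.Uset (SW.latticeOf g) ε k) t₀,
            ∃ w ∈ W, SW.enorm (b - (t₀ + w)) ≤ R) := by
    intro k
    by_cases hk : 1 ≤ k ∧ k ≤ n
    · obtain ⟨R, hR, h⟩ := SW.exists_radius_Uset_component hn hk.1 hk.2 hg hb hε.1
      exact ⟨R, hR, fun _ _ => h⟩
    · exact ⟨1, one_pos, fun h1 h2 => absurd ⟨h1, h2⟩ hk⟩
  choose R hR h using hex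
  refine ⟨∑ k ∈ Finset.range (n + 1), R k,
    Finset.sum_pos (fun k _ => hR k) Finset.nonempty_range_add_one, fun k hk hkn a ha => ?_⟩
  obtain ⟨W, hWk, hW0, hW⟩ := h k hk hkn (SW.logCoord a) ⟨a, ha, rfl⟩
  refine ⟨W, SW.logCoord a, hWk, hW0, fun b hbt => ?_⟩
  obtain ⟨w, hw, hwR⟩ := hW b hbt
  exact ⟨w, hw, hwR.trans (Finset.single_le_sum (fun j _ => (hR j).le)
    (Finset.mem_range.mpr (Nat.lt_succ_of_le hkn)))⟩
end
end

section
/- Let x ∈ ℒ_n be stable, let V ⊆ ℝⁿ be a k-dimensional linear subspace with 1 ≤ k < n such that Λ := x ∩ V has rank k and |Λ| = 1, and let π: ℝⁿ → V^⊥ be the orthogonal projection. Then π(x) is a lattice of covolume 1 in V^⊥ and is stable: every subgroup Λ₀ ⊆ π(x) satisfies |Λ₀| ≥ 1. -/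
open scoped BigOperators
open Matrix Topology Filter

noncomputable section

namespace SW

lemma gvol_eq {n r : ℕ} (v : Fin r → (Fin n → ℝ)) :
    gvol v = Real.sqrt (Matrix.of v * (Matrix.of v)ᵀ).det := by
  unfold gvol
  congr 2

lemma det_gram_nonneg {m ι : Type*} [Fintype m] [Fintype ι] [DecidableEq ι] (M : Matrix ι m ℝ) :
    0 ≤ (M * Mᵀ).det := by
  simpa using (Matrix.posSemidef_self_mul_conjTranspose M).det_nonneg

lemma linearIndependent_iff_det_gram_ne_zero {m ι : Type*} [Fintype m] [Fintype ι] [DecidableEq ι]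
    (M : Matrix ι m ℝ) : LinearIndependent ℝ M.row ↔ (M * Mᵀ).det ≠ 0 := by
  rw [← Matrix.vecMul_injective_iff, ← isUnit_iff_ne_zero, ← Matrix.isUnit_iff_isUnit_det,
    ← Matrix.vecMul_injective_iff_isUnit]
  change Function.Injective M.vecMulLinear ↔ Function.Injective (M * Mᵀ).vecMulLinear
  rw [injective_iff_map_eq_zero', injective_iff_map_eq_zero']
  refine forall_congr' fun x => ?_
  have := Matrix.vecMul_self_mul_conjTranspose_eq_zero M x
  simp only [Matrix.conjTranspose_eq_transpose_of_trivial] at this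
  simp [this]

/-- The Gram determinant of a family `b, u` is the product of those of `b` and of the projection
of `u` orthogonally to the span of `b`. -/
lemma det_gram_fromRows {m ι κ : Type*} [Fintype m] [Fintype ι] [DecidableEq ι] [Fintype κ]
    [DecidableEq κ] (B : Matrix ι m ℝ) (P : Matrix κ m ℝ) (C : Matrix κ ι ℝ) (h : P * Bᵀ = 0) :
    (Matrix.fromRows B (P + C * B) * (Matrix.fromRows B (P + C * B))ᵀ).det =
      (B * Bᵀ).det * (P * Pᵀ).det := by
  have h' : B * Pᵀ = 0 := by simpa using congrArg Matrix.transpose h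
  have key : Matrix.fromRows B (P + C * B) * (Matrix.fromRows B (P + C * B))ᵀ =
      Matrix.fromBlocks 1 0 C 1 * Matrix.fromBlocks (B * Bᵀ) 0 0 (P * Pᵀ) *
        (Matrix.fromBlocks 1 0 C 1)ᵀ := by
    rw [Matrix.transpose_fromRows, Matrix.fromRows_mul_fromCols, Matrix.fromBlocks_transpose,
      Matrix.fromBlocks_multiply, Matrix.fromBlocks_multiply]
    congr 1
    · simp
    · simp [Matrix.mul_add, h', Matrix.mul_assoc]
    · simp [Matrix.add_mul, h, Matrix.mul_assoc]
    · have h1 : P * (Bᵀ * Cᵀ) = 0 := by rw [← Matrix.mul_assoc, h, Matrix.zero_mul]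
      simp [Matrix.add_mul, Matrix.mul_add, Matrix.mul_assoc, h1, h', add_comm]
  rw [key]
  simp [Matrix.det_mul]

lemma exists_int_matrix {n ι κ : Type*} [Fintype ι] {v : ι → (n → ℝ)} {w : κ → (n → ℝ)}
    (h : ∀ i, w i ∈ AddSubgroup.closure (Set.range v)) :
    ∃ A : Matrix κ ι ℤ, Matrix.of w = A.map (Int.cast : ℤ → ℝ) * Matrix.of v := by
  have h' : ∀ i, ∃ c : ι → ℤ, ∑ j, c j • v j = w i := fun i => by
    have := h i
    rw [← Submodule.span_int_eq_addSubgroupClosure, Submodule.mem_toAddSubgroup] at this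
    exact (Submodule.mem_span_range_iff_exists_fun ℤ).1 this
  choose A hA using h'
  refine ⟨Matrix.of A, ?_⟩
  ext i j
  simp [← hA, Matrix.mul_apply, Finset.sum_apply]

lemma span_closure {n ι : Type*} (v : ι → (n → ℝ)) :
    Submodule.span ℝ (AddSubgroup.closure (Set.range v) : Set (n → ℝ)) =
      Submodule.span ℝ (Set.range v) :=
  le_antisymm (Submodule.span_le.2
    ((AddSubgroup.closure_le (Submodule.span ℝ (Set.range v)).toAddSubgroup).2
      Submodule.subset_span)) (Submodule.span_mono AddSubgroup.subset_closure)

lemma gvol_le {n r : ℕ} {v w : Fin r → (Fin n → ℝ)} (hw : LinearIndependent ℝ w)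
    (h : ∀ i, w i ∈ AddSubgroup.closure (Set.range v)) : gvol v ≤ gvol w := by
  obtain ⟨A, hA⟩ := exists_int_matrix h
  have hdet : (Matrix.of w * (Matrix.of w)ᵀ).det =
      (A.det : ℝ) ^ 2 * (Matrix.of v * (Matrix.of v)ᵀ).det := by
    have e : Matrix.of w * (Matrix.of w)ᵀ = A.map (Int.cast : ℤ → ℝ) *
        (Matrix.of v * (Matrix.of v)ᵀ) * (A.map (Int.cast : ℤ → ℝ))ᵀ := by
      rw [hA, Matrix.transpose_mul]
      simp only [Matrix.mul_assoc]
    rw [e, Matrix.det_mul, Matrix.det_mul, Matrix.det_transpose, Int.cast_det]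
    ring
  have hA0 : A.det ≠ 0 := by
    rintro h0
    refine (linearIndependent_iff_det_gram_ne_zero (Matrix.of w)).1 hw ?_
    simp [hdet, h0]
  have h1 : (1 : ℝ) ≤ (A.det : ℝ) ^ 2 := by
    exact_mod_cast Order.one_le_iff_pos.2 (by positivity : 0 < A.det ^ 2)
  rw [gvol_eq, gvol_eq, hdet]
  exact Real.sqrt_le_sqrt (le_mul_of_one_le_left (det_gram_nonneg _) h1)

lemma covol_closure_fin {n r : ℕ} {v : Fin r → (Fin n → ℝ)} (hv : LinearIndependent ℝ v) :
    covol (AddSubgroup.closure (Set.range v)) = gvol v := by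
  have : {c | covolSpec (AddSubgroup.closure (Set.range v)) c} = {gvol v} := by
    ext c
    refine ⟨?_, fun hc => ⟨r, v, hv, rfl, hc⟩⟩
    rintro ⟨s, w, hw, hvw, rfl⟩
    have hrs : r = s := by
      have h1 := finrank_span_eq_card hv
      have h2 := finrank_span_eq_card hw
      rw [← span_closure, hvw, span_closure, h2] at h1
      simpa using h1.symm
    subst hrs
    refine le_antisymm (gvol_le hv fun i => ?_) (gvol_le hw fun i => ?_)
    · rw [← hvw]
      exact AddSubgroup.subset_closure ⟨i, rfl⟩
    · rw [hvw]
      exact AddSubgroup.subset_closure ⟨i, rfl⟩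
  rw [covol, this, csInf_singleton]

lemma covol_closure {n : ℕ} {ι : Type*} [Fintype ι] [DecidableEq ι] {v : ι → (Fin n → ℝ)}
    (hv : LinearIndependent ℝ v) : covol (AddSubgroup.closure (Set.range v)) =
      Real.sqrt (Matrix.of v * (Matrix.of v)ᵀ).det := by
  let e := (Fintype.equivFin ι).symm
  have h := covol_closure_fin (hv.comp e e.injective)
  rw [e.surjective.range_comp, gvol_eq] at h
  rw [h, ← Matrix.det_submatrix_equiv_self e]
  rfl

lemma linearIndependent_of_discrete {n : ℕ} {ι : Type*} [Finite ι] {v : ι → (Fin n → ℝ)}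
    (hv : LinearIndependent ℤ v) (h : DiscreteTopology (AddSubgroup.closure (Set.range v))) :
    LinearIndependent ℝ v := by
  cases nonempty_fintype ι
  rw [← Submodule.span_int_eq_addSubgroupClosure] at h
  have h' : DiscreteTopology (Submodule.span ℤ (Set.range v)) := h
  rw [linearIndependent_iff_card_eq_finrank_span, Real.finrank_eq_int_finrank_of_discrete h',
    Set.finrank, finrank_span_eq_card hv]

lemma exists_int_basis {n : ℕ} {Λ : AddSubgroup (Fin n → ℝ)} (h : Λ.FG) :
    ∃ (r : ℕ) (v : Fin r → (Fin n → ℝ)), LinearIndependent ℤ v ∧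
      Λ = AddSubgroup.closure (Set.range v) := by
  let N := AddSubgroup.toIntSubmodule Λ
  have : Module.Finite ℤ N := Module.Finite.iff_fg.2 ((Submodule.fg_iff_addSubgroup_fg _).2 h)
  obtain ⟨r, b⟩ := Module.basisOfFiniteTypeTorsionFree' (R := ℤ) (M := N)
  refine ⟨r, fun i => b i, b.linearIndependent.map' N.subtype N.ker_subtype, ?_⟩
  have h1 : Submodule.span ℤ (Set.range fun i => (b i : Fin n → ℝ)) = N := by
    have : (Set.range fun i => (b i : Fin n → ℝ)) = N.subtype '' Set.range b := by
      rw [← Set.range_comp]; rfl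
    rw [this, ← Submodule.map_span, b.span_eq, Submodule.map_subtype_top]
  rw [← Submodule.span_int_eq_addSubgroupClosure, h1]
  rfl

lemma fg_of_discrete {n : ℕ} {Λ : AddSubgroup (Fin n → ℝ)} (h : DiscreteTopology Λ) : Λ.FG := by
  have h' : DiscreteTopology (AddSubgroup.toIntSubmodule Λ) := h
  have := Module.Finite.iff_fg.1
    (instModuleFinite_of_discrete_submodule (AddSubgroup.toIntSubmodule Λ))
  exact (Submodule.fg_iff_addSubgroup_fg _).1 this

lemma fg_map {G H : Type*} [AddGroup G] [AddGroup H] {Λ : AddSubgroup G} (h : Λ.FG)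
    (f : G →+ H) : (Λ.map f).FG := by
  classical
  obtain ⟨S, rfl⟩ := h
  exact ⟨S.image f, by rw [AddMonoidHom.map_closure, Finset.coe_image]⟩

lemma exists_basis {n : ℕ} {Λ : AddSubgroup (Fin n → ℝ)} (h : DiscreteTopology Λ) :
    ∃ (r : ℕ) (v : Fin r → (Fin n → ℝ)), LinearIndependent ℝ v ∧
      Λ = AddSubgroup.closure (Set.range v) := by
  obtain ⟨r, v, hv, rfl⟩ := exists_int_basis (fg_of_discrete h)
  exact ⟨r, v, linearIndependent_of_discrete hv h, rfl⟩

lemma discrete_of_le {n : ℕ} {Λ Λ' : AddSubgroup (Fin n → ℝ)} (h : DiscreteTopology Λ')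
    (hle : Λ ≤ Λ') : DiscreteTopology Λ :=
  DiscreteTopology.of_subset (s := (Λ' : Set (Fin n → ℝ))) h hle

lemma exists_orthogonal_projection {n : ℕ} (V : Submodule ℝ (Fin n → ℝ)) :
    ∃ π : (Fin n → ℝ) →ₗ[ℝ] (Fin n → ℝ), ∀ x, π x ∈ orthoC V ∧ x - π x ∈ V := by
  let e := (WithLp.linearEquiv 2 ℝ (Fin n → ℝ)).symm
  let W : Submodule ℝ (EuclideanSpace ℝ (Fin n)) := V.map e.toLinearMap
  refine ⟨e.symm.toLinearMap ∘ₗ Wᗮ.starProjection.toLinearMap ∘ₗ e.toLinearMap, fun x => ⟨?_, ?_⟩⟩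
  · intro v hv
    have h := Submodule.starProjection_apply_mem Wᗮ (e x)
    have := (Submodule.mem_orthogonal _ _).1 h (e v) ⟨v, hv, rfl⟩
    simpa [einner, PiLp.inner_apply, e] using this
  · have h : e x - Wᗮ.starProjection (e x) ∈ W := by
      have := Submodule.sub_starProjection_mem_orthogonal (K := Wᗮ) (e x)
      rwa [Submodule.orthogonal_orthogonal] at this
    obtain ⟨v, hv, hvx⟩ := h
    have : x - e.symm (Wᗮ.starProjection (e x)) = v := by
      apply e.injective
      rw [map_sub, e.apply_symm_apply]
      exact hvx.symm
    change x - e.symm (Wᗮ.starProjection (e x)) ∈ V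
    rwa [this]

lemma eq_zero_of_mem_orthoC {n : ℕ} {V : Submodule ℝ (Fin n → ℝ)} {x : Fin n → ℝ} (h : x ∈ V)
    (h' : x ∈ orthoC V) : x = 0 :=
  dotProduct_self_eq_zero.1 (h' x h)

/-- Covolumes are multiplicative along an orthogonal projection. -/
lemma covol_closure_sumElim {n : ℕ} {ι κ : Type*} [Fintype ι] [Fintype κ]
    {b : ι → (Fin n → ℝ)} {u p : κ → (Fin n → ℝ)} (hb : LinearIndependent ℝ b)
    (hp : ∀ j, p j ∈ orthoC (Submodule.span ℝ (Set.range b)))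
    (hu : ∀ j, u j - p j ∈ Submodule.span ℝ (Set.range b)) :
    (LinearIndependent ℝ (Sum.elim b u) ↔ LinearIndependent ℝ p) ∧
    (LinearIndependent ℝ p → covol (AddSubgroup.closure (Set.range (Sum.elim b u))) =
      covol (AddSubgroup.closure (Set.range b)) * covol (AddSubgroup.closure (Set.range p))) := by
  classical
  choose C hC using fun j => (Submodule.mem_span_range_iff_exists_fun ℝ).1 (hu j)
  have h1 : Matrix.of p * (Matrix.of b)ᵀ = 0 := by
    ext j i
    exact hp j (b i) (Submodule.subset_span ⟨i, rfl⟩)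
  have h2 : Matrix.of (Sum.elim b u) =
      Matrix.fromRows (Matrix.of b) (Matrix.of p + Matrix.of C * Matrix.of b) := by
    ext (i | j) l
    · rfl
    · have := congrFun (hC j) l
      simp only [Finset.sum_apply, Pi.smul_apply, Pi.sub_apply, smul_eq_mul] at this
      simp [Matrix.mul_apply, this]
  have h3 := det_gram_fromRows _ _ (Matrix.of C) h1
  rw [← h2] at h3
  have hb' := (linearIndependent_iff_det_gram_ne_zero (Matrix.of b)).1 hb
  have hiff : LinearIndependent ℝ (Sum.elim b u) ↔ LinearIndependent ℝ p := by
    refine (linearIndependent_iff_det_gram_ne_zero (Matrix.of (Sum.elim b u))).trans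
      (Iff.trans ?_ (linearIndependent_iff_det_gram_ne_zero (Matrix.of p)).symm)
    rw [h3]
    simp [hb']
  refine ⟨hiff, fun h => ?_⟩
  rw [covol_closure (hiff.2 h), covol_closure hb, covol_closure h, h3,
    Real.sqrt_mul (det_gram_nonneg _)]

lemma discrete_closure {n : ℕ} {ι : Type*} {v : ι → (Fin n → ℝ)} (hv : LinearIndependent ℝ v) :
    DiscreteTopology (AddSubgroup.closure (Set.range v)) := by
  let B := Module.Basis.sumExtend hv
  have := Module.Finite.finite_basis B
  have h : DiscreteTopology (Submodule.span ℤ (Set.range B)).toAddSubgroup :=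
    inferInstanceAs (DiscreteTopology (Submodule.span ℤ (Set.range B)))
  refine discrete_of_le h ((AddSubgroup.closure_le _).2 ?_)
  rintro _ ⟨i, rfl⟩
  refine Submodule.subset_span ⟨Sum.inl i, ?_⟩
  simp only [B, Module.Basis.sumExtend, Module.Basis.reindex_apply, Module.Basis.extend_apply_self]
  rfl

lemma projLat_eq_map {n : ℕ} {V : Submodule ℝ (Fin n → ℝ)} (L : AddSubgroup (Fin n → ℝ))
    {π : (Fin n → ℝ) →ₗ[ℝ] (Fin n → ℝ)} (hπ : ∀ x, π x ∈ orthoC V ∧ x - π x ∈ V) :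
    projLat V L = L.map π.toAddMonoidHom := by
  ext p
  constructor
  · rintro ⟨hp, u, hu, hup⟩
    refine ⟨u, hu, sub_eq_zero.1 (eq_zero_of_mem_orthoC (V := V) ?_ ?_)⟩
    · have := V.sub_mem hup (hπ u).2
      rwa [sub_sub_sub_cancel_left] at this
    · exact (orthoC V).sub_mem (hπ u).1 hp
  · rintro ⟨u, hu, rfl⟩
    exact ⟨(hπ u).1, u, hu, (hπ u).2⟩

lemma span_projLat {n : ℕ} (V : Submodule ℝ (Fin n → ℝ)) {L : AddSubgroup (Fin n → ℝ)}
    (hL : Submodule.span ℝ (L : Set (Fin n → ℝ)) = ⊤) :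
    Submodule.span ℝ (projLat V L : Set (Fin n → ℝ)) = orthoC V := by
  obtain ⟨π, hπ⟩ := exists_orthogonal_projection V
  refine le_antisymm (Submodule.span_le.2 fun p hp => hp.1) fun w hw => ?_
  have hw' : w = π w := sub_eq_zero.1
    (eq_zero_of_mem_orthoC (hπ w).2 ((orthoC V).sub_mem hw (hπ w).1))
  have h : π w ∈ (Submodule.span ℝ (L : Set (Fin n → ℝ))).map π := ⟨w, by simp [hL], rfl⟩
  rw [Submodule.map_span] at h
  rw [projLat_eq_map L hπ, hw']
  exact h

/-- A ℤ-basis of `L ∩ V` and lifts of a ℤ-basis of `π(L)` form a ℤ-basis of `L`. -/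
lemma int_basis_sumElim {n : ℕ} {V : Submodule ℝ (Fin n → ℝ)} {L : AddSubgroup (Fin n → ℝ)}
    {ι κ : Type*} [Fintype ι] [Fintype κ] {b : ι → (Fin n → ℝ)} {u p : κ → (Fin n → ℝ)}
    (hb : LinearIndependent ℤ b) (hbL : L ⊓ V.toAddSubgroup = AddSubgroup.closure (Set.range b))
    (hp : LinearIndependent ℤ p) (hpL : projLat V L = AddSubgroup.closure (Set.range p))
    (huL : ∀ j, u j ∈ L) (hup : ∀ j, u j - p j ∈ V) :
    LinearIndependent ℤ (Sum.elim b u) ∧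
      L = AddSubgroup.closure (Set.range (Sum.elim b u)) := by
  obtain ⟨π, hπ⟩ := exists_orthogonal_projection V
  have hpO : ∀ j, p j ∈ orthoC V := fun j => by
    have : p j ∈ projLat V L := hpL ▸ AddSubgroup.subset_closure ⟨j, rfl⟩
    exact this.1
  have hbLV : ∀ i, b i ∈ L ⊓ V.toAddSubgroup := fun i =>
    hbL ▸ AddSubgroup.subset_closure ⟨i, rfl⟩
  have hsum : ∀ c : κ → ℤ, ∑ j, c j • u j - ∑ j, c j • p j ∈ V := fun c => by
    rw [← Finset.sum_sub_distrib]
    refine V.sum_mem fun j _ => ?_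
    rw [← smul_sub]
    exact V.toAddSubgroup.zsmul_mem (hup j) _
  constructor
  · rw [Fintype.linearIndependent_iff] at hb hp ⊢
    intro c hc
    simp only [Fintype.sum_sum_type, Sum.elim_inl, Sum.elim_inr] at hc
    have hr : ∑ j, c (Sum.inr j) • p j = 0 := by
      refine eq_zero_of_mem_orthoC (V := V) ?_ ?_
      · have h1 : ∑ i, c (Sum.inl i) • b i ∈ V :=
          V.sum_mem fun i _ => V.toAddSubgroup.zsmul_mem (hbLV i).2 _
        have h2 := V.add_mem (hsum fun j => c (Sum.inr j)) h1
        rw [sub_add_eq_add_sub, add_comm, hc, zero_sub] at h2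
        exact V.neg_mem_iff.1 h2
      · exact (orthoC V).sum_mem fun j _ => (orthoC V).toAddSubgroup.zsmul_mem (hpO j) _
    have hr' := hp _ hr
    have hl' := hb (fun i => c (Sum.inl i)) (by simpa [hr'] using hc)
    rintro (i | j)
    exacts [hl' i, hr' j]
  · rw [Set.Sum.elim_range, AddSubgroup.closure_union, ← hbL]
    refine le_antisymm (fun x hx => ?_) (sup_le inf_le_left ((AddSubgroup.closure_le _).2 ?_))
    · have h : π x ∈ projLat V L := ⟨(hπ x).1, x, hx, (hπ x).2⟩
      rw [hpL, ← Submodule.span_int_eq_addSubgroupClosure, Submodule.mem_toAddSubgroup] at h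
      obtain ⟨c, hc⟩ := (Submodule.mem_span_range_iff_exists_fun ℤ).1 h
      have hu : ∑ j, c j • u j ∈ AddSubgroup.closure (Set.range u) :=
        AddSubgroup.sum_mem _ fun j _ =>
          AddSubgroup.zsmul_mem _ (AddSubgroup.subset_closure (Set.mem_range_self j)) _
      have hu' : ∑ j, c j • u j ∈ L := L.sum_mem fun j _ => L.zsmul_mem (huL j) _
      refine AddSubgroup.mem_sup.2 ⟨x - ∑ j, c j • u j, ⟨L.sub_mem hx hu', ?_⟩, _, hu, sub_add_cancel _ _⟩
      have h2 := V.sub_mem (hπ x).2 (hsum c)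
      rwa [hc, sub_sub_sub_cancel_right] at h2
    · rintro _ ⟨j, rfl⟩
      exact huL j

end SW

/-- (From the proof of Corollary 1.3.) If `x ∈ ℒ_n` is stable, `V` is a `k`-dimensional
subspace (`1 ≤ k < n`) with `Λ = x ∩ V` of rank `k` and covolume `1`, and `π : ℝⁿ → V^⊥` is
the orthogonal projection, then `π(x)` is a lattice of covolume `1` in `V^⊥` and is stable. -/
theorem SW.projection_of_stable_is_stable (n k : ℕ) (hk1 : 1 ≤ k) (hk2 : k < n)
    (L : AddSubgroup (Fin n → ℝ)) (hL : SW.IsStable L)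
    (V : Submodule ℝ (Fin n → ℝ)) (hV : Module.finrank ℝ V = k)
    (hrk : SW.rk (L ⊓ V.toAddSubgroup) = k)
    (hcv : SW.covol (L ⊓ V.toAddSubgroup) = 1) :
    DiscreteTopology ↥(SW.projLat V L) ∧
      Submodule.span ℝ ((SW.projLat V L : AddSubgroup (Fin n → ℝ)) : Set (Fin n → ℝ)) =
        SW.orthoC V ∧
      SW.covol (SW.projLat V L) = 1 ∧
      ∀ Λ₀ : AddSubgroup (Fin n → ℝ), Λ₀ ≤ SW.projLat V L → 1 ≤ SW.covol Λ₀ := by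
  obtain ⟨⟨⟨hd, hspan⟩, hcov⟩, hst⟩ := hL
  obtain ⟨r, b, hb, hbL⟩ := SW.exists_basis
    (SW.discrete_of_le hd (inf_le_left : L ⊓ V.toAddSubgroup ≤ L))
  have hbV : Submodule.span ℝ (Set.range b) = V := by
    rw [SW.rk, hbL, SW.span_closure] at hrk
    refine Submodule.eq_of_le_of_finrank_eq (Submodule.span_le.2 ?_) (hrk.trans hV.symm)
    rintro _ ⟨i, rfl⟩
    have : b i ∈ L ⊓ V.toAddSubgroup := hbL ▸ AddSubgroup.subset_closure ⟨i, rfl⟩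
    exact this.2
  have hbLL : ∀ i, b i ∈ L := fun i => by
    have : b i ∈ L ⊓ V.toAddSubgroup := hbL ▸ AddSubgroup.subset_closure ⟨i, rfl⟩
    exact this.1
  have hlift : ∀ {s : ℕ} (p : Fin s → Fin n → ℝ), (∀ j, p j ∈ SW.projLat V L) →
      ∃ u : Fin s → Fin n → ℝ, (∀ j, u j ∈ L) ∧ (∀ j, u j - p j ∈ V) ∧
        (LinearIndependent ℝ (Sum.elim b u) ↔ LinearIndependent ℝ p) ∧
        (LinearIndependent ℝ p → SW.covol (AddSubgroup.closure (Set.range (Sum.elim b u))) =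
          SW.covol (AddSubgroup.closure (Set.range p))) := by
    intro s p hp
    choose hpO u huL hup using hp
    have := SW.covol_closure_sumElim (u := u) (p := p) hb
      (fun j => hbV.symm ▸ hpO j) (fun j => hbV.symm ▸ hup j)
    rw [← hbL, hcv, one_mul] at this
    exact ⟨u, huL, hup, this⟩
  obtain ⟨π, hπ⟩ := SW.exists_orthogonal_projection V
  obtain ⟨s, p, hp, hpL⟩ := SW.exists_int_basis (Λ := SW.projLat V L) <| by
    rw [SW.projLat_eq_map L hπ]
    exact SW.fg_map (SW.fg_of_discrete hd) _
  obtain ⟨u, huL, hup, hiff, hcovol⟩ := hlift p fun j => hpL ▸ AddSubgroup.subset_closure ⟨j, rfl⟩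
  obtain ⟨hli, hcl⟩ := SW.int_basis_sumElim (hb.restrict_scalars' ℤ) hbL hp hpL huL hup
  have hpR := hiff.1 (SW.linearIndependent_of_discrete hli (hcl ▸ hd))
  have hdisc : DiscreteTopology (SW.projLat V L) := hpL ▸ SW.discrete_closure hpR
  refine ⟨hdisc, SW.span_projLat V hspan, ?_, fun Λ₀ hΛ₀ => ?_⟩
  · rw [hpL, ← hcovol hpR, ← hcl, hcov]
  · obtain ⟨t, v, hv, rfl⟩ := SW.exists_basis (SW.discrete_of_le hdisc hΛ₀)
    obtain ⟨w, hwL, -, -, hw⟩ := hlift v fun j => hΛ₀ (AddSubgroup.subset_closure ⟨j, rfl⟩)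
    rw [← hw hv]
    refine hst _ ((AddSubgroup.closure_le _).2 ?_)
    rintro _ ⟨i | j, rfl⟩
    exacts [hbLL i, hwL j]
end
end
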